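/- There exist absolute constants c₁, c₂ ∈ ℝ⁺ such that the following holds. Let N be a power of 2, A ∈ ℂ^{N×N} with a fixed singular value decomposition A = Σ_j λ_j u_j v_j*, s, r ∈ {1,…,N}, and ε, p ∈ (0,1). Let H ∈ ℝ^{N×N} be a symmetric orthogonal Hadamard matrix (all entries ±1/√N). Let R ∈ {0,1}^{m×N} be random, formed by independently selecting m rows of the N×N identity matrix uniformly at random with replacement; let D ∈ {−1,0,1}^{N×N} be a random diagonal matrix with i.i.d. Rademacher (±1 each with probability 1/2) entries on its diagonal, independent of R; and set M := √(N/m)·R·H·D. If N ≥ m ≥ c₁·max{s, r/ε²}·log⁴(c₂·N/(p·ε²)), then with probability at least 1−p the matrix M simultaneously satisfies: (1) M has the Restricted Isometry Property of order (4s, 0.1); (2) M is an ε-JL map of the column space of A_r := Σ_{j≤r} λ_j u_j v_j*; (3) M is an ε-JL map of the column space of A_r*; and (4) M is an ε-JL map of the set {u_j : r < j ≤ N} ∪ {v_j : r < j ≤ N} of the smallest N−r left and right singular vectors of A. -/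

import Mathlib

open scoped Matrix Classical

/-- The squared Euclidean (ℓ²) norm of a vector in `ℂ^n`. -/
noncomputable def nsq {n : ℕ} (x : Fin n → ℂ) : ℝ := ∑ i, ‖x i‖ ^ 2

/-- A real matrix `M` is an `ε`-JL map of the set `S ⊆ ℂ^N` (entries coerced into `ℂ`). -/
def IsJLMapR {m N : ℕ} (M : Matrix (Fin m) (Fin N) ℝ) (ε : ℝ) (S : Set (Fin N → ℂ)) : Prop :=
  ∀ x ∈ S, (1 - ε) * nsq x ≤ nsq ((M.map (fun a => (a : ℂ))).mulVec x) ∧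
    nsq ((M.map (fun a => (a : ℂ))).mulVec x) ≤ (1 + ε) * nsq x

/-- A real matrix `M` has the Restricted Isometry Property of order `(s, ε)`. -/
def RIP {m N : ℕ} (M : Matrix (Fin m) (Fin N) ℝ) (s : ℕ) (ε : ℝ) : Prop :=
  ∀ x : Fin N → ℂ, Set.ncard {i | x i ≠ 0} ≤ s →
    (1 - ε) * nsq x ≤ nsq ((M.map (fun a => (a : ℂ))).mulVec x) ∧
    nsq ((M.map (fun a => (a : ℂ))).mulVec x) ≤ (1 + ε) * nsq x

/-- The random row-selection matrix determined by `ρ : Fin m → Fin N`: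
its `i`-th row is the `ρ(i)`-th row of the `N × N` identity matrix. -/
def selMat {m N : ℕ} (ρ : Fin m → Fin N) : Matrix (Fin m) (Fin N) ℝ :=
  fun i j => if ρ i = j then 1 else 0

/-- The random diagonal sign matrix determined by `δ : Fin N → Bool` (i.i.d. Rademacher). -/
def diagSign {N : ℕ} (δ : Fin N → Bool) : Matrix (Fin N) (Fin N) ℝ :=
  Matrix.diagonal (fun i => if δ i then 1 else -1)

/-- The head `A_r = Σ_{j ≤ r} λ_j u_j v_j*` of a singular value decomposition. -/
noncomputable def headMat {N : ℕ} (lam : Fin N → ℝ) (u v : Fin N → Fin N → ℂ) (r : ℕ) :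
    Matrix (Fin N) (Fin N) ℂ :=
  ∑ j : Fin N, if (j : ℕ) < r then
    lam j • Matrix.vecMulVec (u j) (fun k => (starRingEnd ℂ) (v j k)) else 0

namespace SubsampledHadamard

open Finset

section Probability

variable {α β ι : Type*} [Fintype α] [Fintype β] [Fintype ι]

/-- The average of a real function on a finite type. -/
noncomputable def av (f : α → ℝ) : ℝ := (∑ a, f a) / Fintype.card α

/-- The probability of an event under the uniform distribution on a finite type. -/
noncomputable def pr (P : α → Prop) : ℝ := av fun a => if P a then 1 else 0

lemma av_mono {f g : α → ℝ} (h : ∀ a, f a ≤ g a) : av f ≤ av g :=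
  div_le_div_of_nonneg_right (sum_le_sum fun a _ => h a) (Nat.cast_nonneg _)

lemma av_add (f g : α → ℝ) : av (fun a => f a + g a) = av f + av g := by
  simp [av, sum_add_distrib, add_div]

lemma av_const_mul (c : ℝ) (f : α → ℝ) : av (fun a => c * f a) = c * av f := by
  simp [av, ← mul_sum, mul_div_assoc]

lemma av_sum (f : ι → α → ℝ) : av (fun a => ∑ i, f i a) = ∑ i, av (f i) := by
  simp only [av, ← sum_div]
  rw [sum_comm]

lemma av_const [Nonempty α] (c : ℝ) : av (fun _ : α => c) = c := by
  simp [av]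

lemma av_comp_equiv (e : α ≃ β) (f : β → ℝ) : av (fun a => f (e a)) = av f := by
  simp only [av, Fintype.card_congr e, Equiv.sum_comp e f]

lemma av_prod (f : α × β → ℝ) : av f = av fun a => av fun b => f (a, b) := by
  simp only [av, Fintype.sum_prod_type, Fintype.card_prod, ← sum_div, div_div, Nat.cast_mul]
  rw [mul_comm]

lemma av_prod' (f : α × β → ℝ) : av f = av fun b => av fun a => f (a, b) := by
  rw [← av_comp_equiv (Equiv.prodComm β α) f, av_prod]
  rfl

lemma pr_le_av {P : α → Prop} {f : α → ℝ} (h0 : ∀ a, 0 ≤ f a) (h : ∀ a, P a → 1 ≤ f a) :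
    pr P ≤ av f := by
  refine av_mono fun a => ?_
  split_ifs with ha
  exacts [h a ha, h0 a]

lemma pr_mono {P Q : α → Prop} (h : ∀ a, P a → Q a) : pr P ≤ pr Q := by
  refine pr_le_av (fun a => ?_) fun a ha => ?_
  · split_ifs <;> norm_num
  · simp [h a ha]

lemma pr_or_le (P Q : α → Prop) : pr (fun a => P a ∨ Q a) ≤ pr P + pr Q := by
  simp only [pr, ← av_add]
  refine av_mono fun a => ?_
  by_cases hP : P a <;> by_cases hQ : Q a <;> simp [hP, hQ]

lemma pr_exists_le (P : ι → α → Prop) : pr (fun a => ∃ i, P i a) ≤ ∑ i, pr (P i) := by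
  simp only [pr, ← av_sum]
  refine pr_le_av (fun a => sum_nonneg fun i _ => by split_ifs <;> norm_num) ?_
  rintro a ⟨i, hi⟩
  have := single_le_sum (f := fun i => if P i a then (1 : ℝ) else 0)
    (fun i _ => by split_ifs <;> norm_num) (mem_univ i)
  simpa [hi] using this

lemma pr_prod_le [Nonempty β] {P : α × β → Prop} {G : β → Prop} {c : ℝ}
    (hc : 0 ≤ c) (h : ∀ b, G b → pr (fun a => P (a, b)) ≤ c) :
    pr P ≤ pr (fun b => ¬ G b) + c := by
  rw [pr, av_prod', ← av_const (α := β) c, pr, ← av_add]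
  refine av_mono fun b => ?_
  by_cases hG : G b
  · have := h b hG
    simp only [hG, not_true_eq_false, if_false, zero_add]
    exact this
  · have : av (fun a => if P (a, b) then (1 : ℝ) else 0) ≤ 1 := by
      cases isEmpty_or_nonempty α
      · simp [av]
      · exact (av_mono (g := fun _ => 1) fun a => by split_ifs <;> norm_num).trans_eq
          (av_const 1)
    simp only [hG, not_false_eq_true, if_true]
    linarith

lemma one_sub_pr_not_le [Nonempty α] (P : α → Prop) [DecidablePred P] :
    1 - pr (fun a => ¬ P a) ≤ ((univ.filter P).card : ℝ) / Fintype.card α := by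
  have h1 : ((univ.filter P).card : ℝ) / Fintype.card α = av fun a => if P a then 1 else 0 := by
    simp [av]
  rw [h1, sub_le_iff_le_add, pr, ← av_add]
  refine (av_const (α := α) (1 : ℝ)).symm.trans_le (av_mono fun a => ?_)
  by_cases hP : P a <;> simp [hP]

lemma av_pi_prod (m : ℕ) (φ : α → ℝ) :
    av (fun f : Fin m → α => ∏ i, φ (f i)) = av φ ^ m := by
  simp [av, div_pow, Fintype.sum_pow]

end Probability

section Concentration

variable {α ι : Type*} [Fintype α] [Fintype ι]

/-- The moment generating function of a bounded centred finite random variable. -/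
lemma sum_mul_exp_le {w a : α → ℝ} (hw : ∀ x, 0 ≤ w x) (hw1 : ∑ x, w x = 1)
    (ha : ∑ x, w x * a x = 0) {B l : ℝ} (hB : ∀ x, |a x| ≤ B) (hl : |l| * B ≤ 1) :
    ∑ x, w x * Real.exp (l * a x) ≤ Real.exp (l ^ 2 * B ^ 2) := by
  have key : ∀ x, w x * Real.exp (l * a x) ≤ w x * (1 + l ^ 2 * B ^ 2) + l * (w x * a x) := by
    intro x
    have h1 : |l * a x| ≤ |l| * B := by
      rw [abs_mul]
      exact mul_le_mul_of_nonneg_left (hB x) (abs_nonneg _)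
    have h2 := (abs_le.mp (Real.abs_exp_sub_one_sub_id_le (h1.trans hl))).2
    have h3 : (l * a x) ^ 2 ≤ l ^ 2 * B ^ 2 := by
      rw [← mul_pow, sq_le_sq]
      refine h1.trans ?_
      rw [abs_mul]
      exact mul_le_mul_of_nonneg_left (le_abs_self _) (abs_nonneg _)
    nlinarith [mul_le_mul_of_nonneg_left (h2.trans h3) (hw x)]
  calc ∑ x, w x * Real.exp (l * a x)
      ≤ ∑ x, (w x * (1 + l ^ 2 * B ^ 2) + l * (w x * a x)) := sum_le_sum fun x _ => key x
    _ = 1 + l ^ 2 * B ^ 2 := by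
      rw [sum_add_distrib, ← sum_mul, ← mul_sum, hw1, ha]; ring
    _ ≤ Real.exp (l ^ 2 * B ^ 2) := by
      rw [add_comm]; exact Real.add_one_le_exp _

/-- Chernoff bound for the number of samples falling into a set, for both tails. -/
lemma pr_count_le [Nonempty α] (m : ℕ) (B : α → Prop) {η τ σ : ℝ} (hη : 0 ≤ η) (hη1 : η ≤ 1)
    (hσ : |σ| = 1) :
    pr (fun f : Fin m → α =>
      η * m * pr B + τ * m ≤ σ * ((∑ i, if B (f i) then (1 : ℝ) else 0) - m * pr B))
      ≤ Real.exp (-(η * τ * m)) := by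
  set b := pr B with hb
  have hσ2 : σ ^ 2 = 1 := by rw [← sq_abs, hσ, one_pow]
  set l := σ * η with hl
  have hl1 : |l| ≤ 1 := by rw [hl, abs_mul, hσ, one_mul, abs_of_nonneg hη]; exact hη1
  have hl2 : l ^ 2 = η ^ 2 := by rw [hl, mul_pow, hσ2, one_mul]
  have hmgf : av (fun a => Real.exp (l * if B a then (1 : ℝ) else 0)) ≤
      Real.exp (b * (l + η ^ 2)) := by
    have h1 := (abs_le.mp (Real.abs_exp_sub_one_sub_id_le hl1)).2
    calc _ ≤ av (fun a => 1 + (l + η ^ 2) * if B a then (1 : ℝ) else 0) := by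
          refine av_mono fun a => ?_
          split_ifs
          · rw [mul_one, mul_one]; linarith
          · simp
      _ = 1 + (l + η ^ 2) * b := by rw [av_add, av_const, av_const_mul]; rfl
      _ ≤ _ := by rw [add_comm, mul_comm b]; exact Real.add_one_le_exp _
  calc _ ≤ av (fun f : Fin m → α => Real.exp (-(m * (l * b + η ^ 2 * b + η * τ))) *
          ∏ i, Real.exp (l * if B (f i) then (1 : ℝ) else 0)) := by
        refine pr_le_av (fun f => by positivity) fun f hf => ?_
        rw [← Real.exp_sum, ← Real.exp_add, ← mul_sum]
        refine Real.one_le_exp ?_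
        have := mul_le_mul_of_nonneg_left hf hη
        rw [hl]
        linarith
    _ ≤ Real.exp (-(m * (l * b + η ^ 2 * b + η * τ))) * Real.exp (b * (l + η ^ 2)) ^ m := by
        rw [av_const_mul, av_pi_prod m (fun a => Real.exp (l * if B a then (1 : ℝ) else 0))]
        refine mul_le_mul_of_nonneg_left (pow_le_pow_left₀ ?_ hmgf m) (Real.exp_nonneg _)
        exact div_nonneg (sum_nonneg fun a _ => Real.exp_nonneg _) (Nat.cast_nonneg _)
    _ = _ := by
        rw [← Real.exp_nat_mul, ← Real.exp_add]
        ring_nf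

/-- The sign `±1` encoded by a Boolean. -/
noncomputable def sgn (b : Bool) : ℝ := if b then 1 else -1

lemma abs_sgn (b : Bool) : |sgn b| = 1 := by cases b <;> simp [sgn]

lemma sgn_mul_self (b : Bool) : sgn b * sgn b = 1 := by cases b <;> simp [sgn]

lemma two_mul_le_exp_add {x u : ℝ} (h : u < |x|) {c : ℝ} (hc : 0 ≤ c) :
    1 ≤ Real.exp (c * x + -(c * u)) + Real.exp (-c * x + -(c * u)) := by
  rcases lt_abs.mp h with h | h
  · have : 1 ≤ Real.exp (c * x + -(c * u)) := Real.one_le_exp (by nlinarith)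
    linarith [Real.exp_pos (-c * x + -(c * u))]
  · have : 1 ≤ Real.exp (-c * x + -(c * u)) := Real.one_le_exp (by nlinarith)
    linarith [Real.exp_pos (c * x + -(c * u))]

/-- Empirical approximation: an average `∑ a, w a * G j a` with bounded `G` is approximated
simultaneously for all `j` by the empirical mean of few samples. -/
lemma exists_empirical {w : α → ℝ} (hw : ∀ x, 0 ≤ w x) (hw1 : ∑ x, w x = 1)
    (G : ι → α → ℝ) {R u : ℝ} (hR : 0 < R) (hG : ∀ j a, |G j a| ≤ R) (hu : 0 < u)
    (huR : u ≤ 4 * R) {n : ℕ}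
    (hn : 2 * (Fintype.card ι : ℝ) * Real.exp (-(n * u ^ 2 / (16 * R ^ 2))) < 1) :
    ∃ f : Fin n → α, ∀ j, |∑ l, (G j (f l) - ∑ a, w a * G j a)| ≤ n * u := by
  by_contra hcon
  push Not at hcon
  set c := u / (8 * R ^ 2) with hc
  have hc0 : 0 ≤ c := by positivity
  have hcR : c * (2 * R) ≤ 1 := by
    rw [hc, div_mul_eq_mul_div, div_le_one (by positivity)]; nlinarith
  set a : ι → α → ℝ := fun j x => G j x - ∑ a, w a * G j a with ha
  have ha0 : ∀ j, ∑ x, w x * a j x = 0 := by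
    intro j; simp [ha, mul_sub, ← sum_mul, hw1]
  have haB : ∀ j x, |a j x| ≤ 2 * R := by
    intro j x
    have h1 : |∑ a, w a * G j a| ≤ R := by
      calc |∑ a, w a * G j a| ≤ ∑ a, |w a * G j a| := abs_sum_le_sum_abs _ _
        _ ≤ ∑ a, w a * R := sum_le_sum fun b _ => by
            rw [abs_mul, abs_of_nonneg (hw b)]; exact mul_le_mul_of_nonneg_left (hG j b) (hw b)
        _ = R := by rw [← sum_mul, hw1, one_mul]
    have := abs_sub (G j x) (∑ a, w a * G j a)
    linarith [hG j x]
  have hmgf : ∀ l : ℝ, |l| = c → ∀ j, ∑ f : Fin n → α, (∏ i, w (f i)) *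
      Real.exp (l * (∑ i, a j (f i)) + -(c * (n * u))) ≤
        Real.exp (-(n * u ^ 2 / (16 * R ^ 2))) := by
    intro l hl j
    have h1 := sum_mul_exp_le hw hw1 (ha0 j) (haB j) (l := l) (by rw [hl]; exact hcR)
    have h2 : ∀ f : Fin n → α, (∏ i, w (f i)) *
      Real.exp (l * (∑ i, a j (f i)) + -(c * (n * u))) =
        (∏ i, w (f i) * Real.exp (l * a j (f i))) * Real.exp (-(c * (n * u))) := by
      intro f
      rw [Real.exp_add, prod_mul_distrib, ← Real.exp_sum, mul_sum, mul_assoc]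
    simp only [h2]
    rw [← sum_mul, ← Fintype.sum_pow (fun x => w x * Real.exp (l * a j x))]
    have h3 := pow_le_pow_left₀ (sum_nonneg fun x _ =>
      mul_nonneg (hw x) (Real.exp_nonneg _)) h1 n
    refine (mul_le_mul_of_nonneg_right h3 (Real.exp_nonneg _)).trans_eq ?_
    rw [← Real.exp_nat_mul, ← Real.exp_add, ← sq_abs l, hl, hc]
    congr 1
    field_simp
    ring
  have hone : (1 : ℝ) = ∑ f : Fin n → α, ∏ i, w (f i) := by
    rw [← Fintype.sum_pow, hw1, one_pow]
  have hle : ∀ f : Fin n → α, ∏ i, w (f i) ≤ ∑ j, ((∏ i, w (f i)) *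
      Real.exp (c * (∑ i, a j (f i)) + -(c * (n * u))) + (∏ i, w (f i)) *
      Real.exp (-c * (∑ i, a j (f i)) + -(c * (n * u)))) := by
    intro f
    obtain ⟨j, hj⟩ := hcon f
    have hP : 0 ≤ ∏ i, w (f i) := prod_nonneg fun i _ => hw _
    refine le_trans ?_ (single_le_sum (fun j _ => by positivity) (mem_univ j))
    rw [← mul_add]
    exact le_mul_of_one_le_right hP (two_mul_le_exp_add hj hc0)
  have : (1 : ℝ) ≤ ∑ _j : ι, 2 * Real.exp (-(n * u ^ 2 / (16 * R ^ 2))) := by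
    refine (hone.trans_le (sum_le_sum fun f _ => hle f)).trans ?_
    rw [sum_comm]
    refine sum_le_sum fun j _ => ?_
    rw [sum_add_distrib, two_mul]
    exact add_le_add (hmgf c (abs_of_nonneg hc0) j)
      (hmgf (-c) (by rw [abs_neg, abs_of_nonneg hc0]) j)
  rw [sum_const, card_univ, nsmul_eq_mul] at this
  linarith

/-- Maurey's empirical method for vectors in the `ℓ¹` ball of radius `R`. -/
lemma exists_sparse_approx {κ : Type*} [Fintype κ] (g : ι → κ → ℝ) (hg : ∀ j k, |g j k| ≤ 1)
    (x : κ → ℝ) {R u : ℝ} (hR : 0 < R) (hx : ∑ k, |x k| ≤ R) (hu : 0 < u) (huR : u ≤ 4 * R)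
    [Nonempty κ] {n : ℕ} (hn0 : 0 < n)
    (hn : 2 * (Fintype.card ι : ℝ) * Real.exp (-(n * u ^ 2 / (16 * R ^ 2))) < 1) :
    ∃ f : Fin n → κ × Bool, ∀ j,
      |(R / n) * ∑ l, sgn (f l).2 * g j (f l).1 - ∑ k, g j k * x k| ≤ u := by
  set e : ℝ := (1 - (∑ k, |x k|) / R) / (2 * Fintype.card κ) with he
  have hcard : (0 : ℝ) < Fintype.card κ := by exact_mod_cast Fintype.card_pos
  have he0 : 0 ≤ e := by
    refine div_nonneg (sub_nonneg.mpr ((div_le_one hR).mpr hx)) (by positivity)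
  set w : κ × Bool → ℝ := fun a => (|x a.1| + sgn a.2 * x a.1) / (2 * R) + e with hw
  have hw0 : ∀ a, 0 ≤ w a := by
    intro a
    have : 0 ≤ |x a.1| + sgn a.2 * x a.1 := by
      have := neg_abs_le (sgn a.2 * x a.1)
      rw [abs_mul, abs_sgn, one_mul] at this
      linarith
    positivity
  have hw1 : ∑ a, w a = 1 := by
    rw [Fintype.sum_prod_type]
    have : ∀ k, ∑ b, w (k, b) = |x k| / R + 2 * e := by
      intro k; simp [hw, sgn]; field_simp; ring
    simp only [this, sum_add_distrib, ← sum_div, sum_const, card_univ, nsmul_eq_mul]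
    rw [he]; field_simp; ring
  have hmean : ∀ j, ∑ a, w a * (R * (sgn a.2 * g j a.1)) = ∑ k, g j k * x k := by
    intro j
    rw [Fintype.sum_prod_type]
    refine sum_congr rfl fun k _ => ?_
    simp [hw, sgn]; field_simp; ring
  obtain ⟨f, hf⟩ := exists_empirical hw0 hw1 (fun j a => R * (sgn a.2 * g j a.1)) hR
    (fun j a => by
      rw [abs_mul, abs_mul, abs_sgn, one_mul, abs_of_pos hR]
      exact mul_le_of_le_one_right hR.le (hg _ _)) hu huR hn
  refine ⟨f, fun j => ?_⟩
  have hn' : (0 : ℝ) < n := by exact_mod_cast hn0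
  have h := hf j
  rw [hmean, sum_sub_distrib, sum_const, card_univ, Fintype.card_fin, nsmul_eq_mul, ← mul_sum] at h
  have h2 : R * ∑ l, sgn (f l).2 * g j (f l).1 - n * ∑ k, g j k * x k =
      n * (R / n * ∑ l, sgn (f l).2 * g j (f l).1 - ∑ k, g j k * x k) := by
    field_simp
  rw [h2, abs_mul, abs_of_pos hn'] at h
  exact le_of_mul_le_mul_left h hn'

end Concentration

section MatrixMoments

open Matrix

variable {ι : Type*} [Fintype ι] [DecidableEq ι]

lemma exists_spectral {A : Matrix ι ι ℝ} (hA : Aᵀ = A) :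
    ∃ (U : Matrix ι ι ℝ) (l : ι → ℝ), Uᵀ * U = 1 ∧ U * Uᵀ = 1 ∧
      ∀ n : ℕ, A ^ n = U * diagonal (fun i => l i ^ n) * Uᵀ := by
  have hH : A.IsHermitian := by rw [IsHermitian, conjTranspose_eq_transpose_of_trivial, hA]
  set U : Matrix ι ι ℝ := (hH.eigenvectorUnitary : Matrix ι ι ℝ)
  have hU : star U = Uᵀ := by rw [star_eq_conjTranspose, conjTranspose_eq_transpose_of_trivial]
  have h1 : Uᵀ * U = 1 := hU ▸ Unitary.coe_star_mul_self hH.eigenvectorUnitary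
  have h2 : U * Uᵀ = 1 := hU ▸ Unitary.coe_mul_star_self hH.eigenvectorUnitary
  refine ⟨U, hH.eigenvalues, h1, h2, fun n => ?_⟩
  have hs : A = U * diagonal hH.eigenvalues * Uᵀ := by
    have := hH.spectral_theorem
    rw [Unitary.conjStarAlgAut_apply, ← Unitary.coe_star] at this
    rw [← hU]
    exact this
  induction n with
  | zero => simp [h2]
  | succ n ih =>
    rw [pow_succ, ih]
    nth_rewrite 2 [hs]
    calc U * diagonal (fun i => hH.eigenvalues i ^ n) * Uᵀ * (U * diagonal hH.eigenvalues * Uᵀ)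
        = U * (diagonal (fun i => hH.eigenvalues i ^ n) * ((Uᵀ * U) * diagonal hH.eigenvalues)) *
          Uᵀ := by simp only [Matrix.mul_assoc]
      _ = _ := by rw [h1, Matrix.one_mul, diagonal_mul_diagonal]; simp only [pow_succ]

lemma trace_conj_diagonal {U : Matrix ι ι ℝ} (hU : Uᵀ * U = 1) (l : ι → ℝ) :
    (U * diagonal l * Uᵀ).trace = ∑ i, l i := by
  rw [trace_mul_comm, ← Matrix.mul_assoc, hU, Matrix.one_mul, trace_diagonal]

lemma exists_trace_form {A B H : Matrix ι ι ℝ} (hA : Aᵀ = A) (hB : Bᵀ = B) (hH : Hᵀ = H) :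
    ∃ (a b : ι → ℝ) (G : Matrix ι ι ℝ), ∀ l k : ℕ,
      (H * A ^ l * H * B ^ k).trace = ∑ i, ∑ j, a i ^ l * b j ^ k * G i j ^ 2 := by
  obtain ⟨U, a, -, -, ha⟩ := exists_spectral hA
  obtain ⟨V, b, -, -, hb⟩ := exists_spectral hB
  refine ⟨a, b, Uᵀ * H * V, fun l k => ?_⟩
  set G := Uᵀ * H * V with hG
  have hGt : Gᵀ = Vᵀ * H * U := by
    rw [hG, transpose_mul, transpose_mul, transpose_transpose, hH, Matrix.mul_assoc]
  have h1 : (H * A ^ l * H * B ^ k).trace =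
      (Gᵀ * diagonal (fun i => a i ^ l) * G * diagonal (fun i => b i ^ k)).trace := by
    rw [ha, hb, hGt, hG, ← Matrix.mul_assoc, ← Matrix.mul_assoc, trace_mul_comm]
    simp only [Matrix.mul_assoc]
  rw [h1, trace, sum_comm]
  refine sum_congr rfl fun j _ => ?_
  rw [diag_apply, mul_diagonal, mul_apply, sum_mul]
  refine sum_congr rfl fun i _ => ?_
  rw [mul_diagonal, transpose_apply]
  ring

lemma sum_pow_mul_pow_le {n : ℕ} (hn : Even n) (x y : ℝ) :
    ∑ l ∈ range (n + 1), x ^ l * y ^ (n - l) ≤ (n + 1) / 2 * (x ^ n + y ^ n) := by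
  have key : ∀ l ∈ range (n + 1), x ^ l * y ^ (n - l) + x ^ (n - l) * y ^ l ≤ x ^ n + y ^ n := by
    intro l hl
    have hl' : l ≤ n := Nat.lt_succ_iff.mp (mem_range.mp hl)
    rw [← hn.pow_abs x, ← hn.pow_abs y]
    have h1 : x ^ l * y ^ (n - l) ≤ |x| ^ l * |y| ^ (n - l) := by
      rw [← abs_pow, ← abs_pow, ← abs_mul]; exact le_abs_self _
    have h2 : x ^ (n - l) * y ^ l ≤ |x| ^ (n - l) * |y| ^ l := by
      rw [← abs_pow, ← abs_pow, ← abs_mul]; exact le_abs_self _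
    have h3 : 0 ≤ (|x| ^ l - |y| ^ l) * (|x| ^ (n - l) - |y| ^ (n - l)) := by
      rcases le_total |x| |y| with h | h
      · exact mul_nonneg_of_nonpos_of_nonpos
          (sub_nonpos.mpr (pow_le_pow_left₀ (abs_nonneg _) h _))
          (sub_nonpos.mpr (pow_le_pow_left₀ (abs_nonneg _) h _))
      · exact mul_nonneg (sub_nonneg.mpr (pow_le_pow_left₀ (abs_nonneg _) h _))
          (sub_nonneg.mpr (pow_le_pow_left₀ (abs_nonneg _) h _))
    have h4 : ∀ z : ℝ, z ^ l * z ^ (n - l) = z ^ n := fun z => by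
      rw [← pow_add, Nat.add_sub_cancel' hl']
    nlinarith [h4 |x|, h4 |y|]
  have hrefl : ∑ l ∈ range (n + 1), x ^ (n - l) * y ^ l =
      ∑ l ∈ range (n + 1), x ^ l * y ^ (n - l) := by
    rw [← sum_range_reflect]
    refine sum_congr rfl fun l hl => ?_
    have hl' : l ≤ n := Nat.lt_succ_iff.mp (mem_range.mp hl)
    rw [show n + 1 - 1 - l = n - l by omega, show n - (n - l) = l by omega]
  have := sum_le_sum key
  rw [sum_add_distrib, hrefl, sum_const, card_range, nsmul_eq_mul] at this
  push_cast at this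
  linarith

/-- An arithmetic–geometric mean inequality for traces. -/
lemma sum_trace_le {n : ℕ} (hn : Even n) {A B H : Matrix ι ι ℝ} (hA : Aᵀ = A) (hB : Bᵀ = B)
    (hH : Hᵀ = H) :
    ∑ l ∈ range (n + 1), (H * A ^ l * H * B ^ (n - l)).trace ≤
      (n + 1) / 2 * ((H * H * A ^ n).trace + (H * H * B ^ n).trace) := by
  obtain ⟨a, b, G, hG⟩ := exists_trace_form hA hB hH
  have h1 : (H * H * A ^ n).trace = (H * A ^ n * H * B ^ 0).trace := by
    rw [pow_zero, Matrix.mul_one, trace_mul_comm (H * A ^ n), ← Matrix.mul_assoc]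
  have h2 : (H * H * B ^ n).trace = (H * A ^ 0 * H * B ^ n).trace := by
    rw [pow_zero, Matrix.mul_one]
  rw [h1, h2]
  simp only [hG]
  rw [sum_comm, ← sum_add_distrib, mul_sum]
  refine sum_le_sum fun i _ => ?_
  rw [sum_comm, ← sum_add_distrib, mul_sum]
  refine sum_le_sum fun j _ => ?_
  rw [← sum_mul]
  have := mul_le_mul_of_nonneg_right (sum_pow_mul_pow_le hn (a i) (b j)) (sq_nonneg (G i j))
  simp only [pow_zero, mul_one, one_mul]
  linarith

lemma trace_mul_mul_pow_nonneg {n : ℕ} (hn : Even n) {A H : Matrix ι ι ℝ} (hA : Aᵀ = A)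
    (hH : Hᵀ = H) : 0 ≤ (H * H * A ^ n).trace := by
  obtain ⟨a, b, G, hG⟩ := exists_trace_form hA hA hH
  have h2 := hG 0 n
  rw [pow_zero, Matrix.mul_one] at h2
  rw [h2]
  exact sum_nonneg fun i _ => sum_nonneg fun j _ =>
    mul_nonneg (mul_nonneg (by simp) (hn.pow_nonneg _)) (sq_nonneg _)

lemma pow_succ_sub_pow_succ {R : Type*} [Ring R] (X Y : R) (n : ℕ) :
    X ^ (n + 1) - Y ^ (n + 1) = ∑ l ∈ range (n + 1), X ^ l * (X - Y) * Y ^ (n - l) := by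
  induction n with
  | zero => simp
  | succ n ih =>
    rw [sum_range_succ, Nat.sub_self, pow_zero, mul_one]
    have : ∀ l ∈ range (n + 1), X ^ l * (X - Y) * Y ^ (n + 1 - l) =
        X ^ l * (X - Y) * Y ^ (n - l) * Y := by
      intro l hl
      rw [Nat.succ_sub (Nat.lt_succ_iff.mp (mem_range.mp hl)), pow_succ, mul_assoc, mul_assoc,
        mul_assoc]
    rw [sum_congr rfl this, ← sum_mul, ← ih]
    rw [pow_succ X (n + 1), pow_succ Y (n + 1)]
    noncomm_ring

lemma trace_sub_mul_pow_sub_pow_le {n : ℕ} (hn : Even n) {X Y : Matrix ι ι ℝ} (hX : Xᵀ = X)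
    (hY : Yᵀ = Y) :
    ((X - Y) * X ^ (n + 1)).trace - ((X - Y) * Y ^ (n + 1)).trace ≤
      (n + 1) / 2 * (((X - Y) * (X - Y) * X ^ n).trace + ((X - Y) * (X - Y) * Y ^ n).trace) := by
  refine le_trans (le_of_eq ?_) (sum_trace_le hn hX hY
    (show (X - Y)ᵀ = X - Y by rw [transpose_sub, hX, hY]))
  rw [← trace_sub, ← Matrix.mul_sub, pow_succ_sub_pow_succ, Matrix.mul_sum, trace_sum]
  simp only [Matrix.mul_assoc]

lemma trace_sub_sq_mul_pow_le {n : ℕ} (hn : Even n) {X Z W : Matrix ι ι ℝ} (hX : Xᵀ = X)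
    (hZ : Zᵀ = Z) (hW : Wᵀ = W) :
    ((Z - W) * (Z - W) * X ^ n).trace ≤
      2 * ((Z * Z * X ^ n).trace + (W * W * X ^ n).trace) := by
  have h := trace_mul_mul_pow_nonneg hn hX (show (Z + W)ᵀ = Z + W by rw [transpose_add, hZ, hW])
  have h2 : (Z - W) * (Z - W) * X ^ n + (Z + W) * (Z + W) * X ^ n =
      2 • (Z * Z * X ^ n + W * W * X ^ n) := by noncomm_ring
  have h3 := congrArg trace h2
  rw [trace_add, trace_smul, trace_add, nsmul_eq_mul] at h3
  push_cast at h3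
  linarith

lemma trace_pow_succ_le {n : ℕ} (hn : Even n) {X : Matrix ι ι ℝ} (hX : Xᵀ = X) (c : ℝ) :
    2 * c * (X ^ (n + 1)).trace ≤ (X ^ (n + 2)).trace + c ^ 2 * (X ^ n).trace := by
  obtain ⟨U, l, hU, -, h⟩ := exists_spectral hX
  rw [h, h, h, trace_conj_diagonal hU, trace_conj_diagonal hU, trace_conj_diagonal hU, mul_sum,
    mul_sum, ← sum_add_distrib]
  refine sum_le_sum fun i _ => ?_
  have := mul_nonneg (hn.pow_nonneg (l i)) (sq_nonneg (l i - c))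
  have h1 : l i ^ (n + 1) = l i ^ n * l i := pow_succ _ _
  have h2 : l i ^ (n + 2) = l i ^ n * l i ^ 2 := pow_add _ _ _
  rw [h1, h2]
  linarith

lemma quadForm_pow_le_trace {n : ℕ} (hn : Even n) {X : Matrix ι ι ℝ} (hX : Xᵀ = X) {c : ι → ℝ}
    (hc : c ⬝ᵥ c = 1) : (c ⬝ᵥ X *ᵥ c) ^ n ≤ (X ^ n).trace := by
  obtain ⟨U, l, hU, hU', h⟩ := exists_spectral hX
  set e := Uᵀ *ᵥ c with he
  have hee : c ᵥ* U = e := by rw [he, mulVec_transpose]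
  have h1 : ∑ i, e i ^ 2 = 1 := by
    calc ∑ i, e i ^ 2 = e ⬝ᵥ e := by simp [dotProduct, sq]
      _ = (c ᵥ* U) ⬝ᵥ (Uᵀ *ᵥ c) := by rw [hee]
      _ = 1 := by rw [dotProduct_mulVec, vecMul_vecMul, hU', vecMul_one, hc]
  have h2 : c ⬝ᵥ X *ᵥ c = ∑ i, e i ^ 2 * l i := by
    have hX1 := h 1
    simp only [pow_one] at hX1
    calc c ⬝ᵥ X *ᵥ c = (c ᵥ* U) ⬝ᵥ (diagonal l *ᵥ (Uᵀ *ᵥ c)) := by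
          rw [hX1, ← mulVec_mulVec, ← mulVec_mulVec, dotProduct_mulVec]
      _ = ∑ i, e i ^ 2 * l i := by
          rw [hee, ← he]
          simp only [dotProduct, mulVec_diagonal]
          exact sum_congr rfl fun i _ => by ring
  rw [h2, h, trace_conj_diagonal hU]
  refine (Real.pow_arith_mean_le_arith_mean_pow_of_even _ _ _ (fun i _ => sq_nonneg _) h1
    hn).trans (sum_le_sum fun i _ => ?_)
  refine mul_le_of_le_one_left (hn.pow_nonneg _) ?_
  rw [← h1]
  exact single_le_sum (f := fun i => e i ^ 2) (fun i _ => sq_nonneg _) (mem_univ i)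

end MatrixMoments

section MomentBound

open Matrix

variable {α ι : Type*}

/-- The sum of the sampled matrices. -/
noncomputable def sampleSum {m : ℕ} (Z : α → Matrix ι ι ℝ) (ρ : Fin m → α) : Matrix ι ι ℝ :=
  ∑ i, Z (ρ i)

lemma sampleSum_transpose {m : ℕ} {Z : α → Matrix ι ι ℝ} (hZ : ∀ j, (Z j)ᵀ = Z j)
    (ρ : Fin m → α) : (sampleSum Z ρ)ᵀ = sampleSum Z ρ := by
  simp [sampleSum, transpose_sum, hZ]

lemma sampleSum_sub_update {m : ℕ} (Z : α → Matrix ι ι ℝ) (ρ : Fin m → α) (i : Fin m) (j : α) :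
    sampleSum Z ρ - sampleSum Z (Function.update ρ i j) = Z (ρ i) - Z j := by
  simp only [sampleSum]
  rw [← sum_sub_distrib, sum_eq_single i]
  · simp
  · intro l _ hl
    simp [hl]
  · simp

variable [Fintype ι] [DecidableEq ι]

lemma trace_rankOne_sub_one_sq_le {n : ℕ} (hn : Even n) (y : ι → ℝ) {κ : ℝ} (hy : y ⬝ᵥ y ≤ κ)
    {X : Matrix ι ι ℝ} (hX : Xᵀ = X) :
    ((vecMulVec y y - 1) * (vecMulVec y y - 1) * X ^ n).trace ≤
      κ * ((vecMulVec y y - 1) * X ^ n).trace + (κ + 1) * (X ^ n).trace := by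
  set V := vecMulVec y y with hV
  have hVV : V * V = (y ⬝ᵥ y) • V := by
    rw [hV, vecMulVec_mul_vecMulVec, vecMulVec_smul]
  have hVt : Vᵀ = V := by rw [hV, transpose_vecMulVec]
  have h0 : 0 ≤ (V * X ^ n).trace := by
    rcases eq_or_ne (y ⬝ᵥ y) 0 with h | h
    · have : y = 0 := dotProduct_self_eq_zero.mp h
      simp [hV, this]
    · have hpos : 0 < y ⬝ᵥ y :=
        lt_of_le_of_ne (sum_nonneg fun i _ => mul_self_nonneg _) h.symm
      have := trace_mul_mul_pow_nonneg hn hX hVt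
      rw [hVV, Matrix.smul_mul, trace_smul, smul_eq_mul] at this
      exact nonneg_of_mul_nonneg_right this hpos
  have h1 : (V - 1) * (V - 1) * X ^ n = (y ⬝ᵥ y) • (V * X ^ n) - 2 • (V * X ^ n) + X ^ n := by
    rw [← Matrix.smul_mul, ← hVV]; noncomm_ring
  rw [h1, Matrix.sub_mul, Matrix.one_mul, trace_add, trace_sub, trace_sub, trace_smul, trace_smul,
    smul_eq_mul, nsmul_eq_mul]
  push_cast
  nlinarith [mul_le_mul_of_nonneg_right hy h0]

variable [Fintype α]

lemma av_exchange {m : ℕ} (i : Fin m) (F : (Fin m → α) × α → ℝ) :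
    av F = av fun x : (Fin m → α) × α => F (Function.update x.1 i x.2, x.1 i) := by
  have hinv : Function.Involutive
      (fun x : (Fin m → α) × α => (Function.update x.1 i x.2, x.1 i)) := by
    rintro ⟨ρ, j⟩
    simp
  exact (av_comp_equiv hinv.toPerm F).symm

lemma av_trace_mul {Z : α → Matrix ι ι ℝ} (hZ : ∑ j, Z j = 0) (P : Matrix ι ι ℝ) :
    av (fun j => (Z j * P).trace) = 0 := by
  rw [av, ← trace_sum, ← Matrix.sum_mul, hZ]
  simp

variable [Nonempty α]

lemma av_trace_sample_mul_pow_le {m n : ℕ} (hn : Even n) {Z : α → Matrix ι ι ℝ}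
    (hZ : ∀ j, (Z j)ᵀ = Z j) (hZ0 : ∑ j, Z j = 0) {κ : ℝ}
    (hκ : ∀ (j : α) (X : Matrix ι ι ℝ), Xᵀ = X → (Z j * Z j * X ^ n).trace ≤
      κ * (Z j * X ^ n).trace + (κ + 1) * (X ^ n).trace) (i : Fin m) :
    av (fun ρ : Fin m → α => (Z (ρ i) * sampleSum Z ρ ^ (n + 1)).trace) ≤
      (n + 1) * (κ * av (fun ρ : Fin m → α => (Z (ρ i) * sampleSum Z ρ ^ n).trace) +
        2 * (κ + 1) * av (fun ρ : Fin m → α => (sampleSum Z ρ ^ n).trace)) := by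
  set X := sampleSum (m := m) Z with hXdef
  have hX : ∀ ρ, (X ρ)ᵀ = X ρ := sampleSum_transpose hZ
  have hn0 : (0 : ℝ) ≤ n + 1 := by positivity
  set F : (Fin m → α) × α → ℝ := fun x => ((Z (x.1 i) - Z x.2) * X x.1 ^ (n + 1)).trace with hF
  set E : (Fin m → α) × α → ℝ := fun x =>
    ((Z (x.1 i) - Z x.2) * (Z (x.1 i) - Z x.2) * X x.1 ^ n).trace with hE
  have hF1 : av F = av (fun ρ : Fin m → α => (Z (ρ i) * X ρ ^ (n + 1)).trace) := by
    rw [av_prod]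
    congr 1
    ext ρ
    have e : ∀ b, F (ρ, b) =
        (Z (ρ i) * X ρ ^ (n + 1)).trace + (-1) * (Z b * X ρ ^ (n + 1)).trace := by
      intro b
      simp only [hF]
      rw [Matrix.sub_mul, trace_sub]
      ring
    simp only [e]
    rw [av_add, av_const, av_const_mul, av_trace_mul hZ0]
    ring
  have hEx : av F + av F ≤ (n + 1) / 2 * (av E + av E) := by
    nth_rewrite 2 [av_exchange i F]
    nth_rewrite 2 [av_exchange i E]
    rw [← av_add, ← av_add, ← av_const_mul]
    refine av_mono ?_
    rintro ⟨ρ, j⟩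
    have h := trace_sub_mul_pow_sub_pow_le hn (hX ρ) (hX (Function.update ρ i j))
    rw [hXdef, sampleSum_sub_update] at h
    simp only [hF, hE, Function.update_self]
    have e1 : ((Z j - Z (ρ i)) * X (Function.update ρ i j) ^ (n + 1)).trace =
        -((Z (ρ i) - Z j) * X (Function.update ρ i j) ^ (n + 1)).trace := by
      rw [← trace_neg, ← Matrix.neg_mul, neg_sub]
    have e2 : (Z j - Z (ρ i)) * (Z j - Z (ρ i)) = (Z (ρ i) - Z j) * (Z (ρ i) - Z j) := by
      noncomm_ring
    rw [e1, e2]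
    linarith
  have hE1 : av E ≤ 2 * (κ * av (fun ρ : Fin m → α => (Z (ρ i) * X ρ ^ n).trace) +
        2 * (κ + 1) * av (fun ρ : Fin m → α => (X ρ ^ n).trace)) := by
    rw [av_prod]
    simp only [mul_add, ← av_const_mul, ← av_add]
    refine av_mono fun ρ => ?_
    have h1 : ∀ j, E (ρ, j) ≤ 2 * (κ * (Z (ρ i) * X ρ ^ n).trace +
        2 * (κ + 1) * (X ρ ^ n).trace) + 2 * κ * (Z j * X ρ ^ n).trace := by
      intro j
      have := trace_sub_sq_mul_pow_le hn (hX ρ) (hZ (ρ i)) (hZ j)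
      have a1 := hκ (ρ i) (X ρ) (hX ρ)
      have a2 := hκ j (X ρ) (hX ρ)
      simp only [hE]
      linarith
    refine (av_mono h1).trans_eq ?_
    rw [av_add, av_const, av_const_mul, av_trace_mul hZ0]
    ring
  rw [← hF1]
  have := mul_le_mul_of_nonneg_left hE1 hn0
  linarith

lemma av_trace_pow_add_two_le {m n : ℕ} (hn : Even n) {Z : α → Matrix ι ι ℝ}
    (hZ : ∀ j, (Z j)ᵀ = Z j) (hZ0 : ∑ j, Z j = 0) {κ : ℝ}
    (hκ : ∀ (j : α) (X : Matrix ι ι ℝ), Xᵀ = X → (Z j * Z j * X ^ n).trace ≤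
      κ * (Z j * X ^ n).trace + (κ + 1) * (X ^ n).trace) :
    av (fun ρ : Fin m → α => (sampleSum Z ρ ^ (n + 2)).trace) ≤
      ((n + 1) ^ 2 * κ ^ 2 + 4 * (n + 1) * (κ + 1) * m) *
        av (fun ρ : Fin m → α => (sampleSum Z ρ ^ n).trace) := by
  have hsum : ∀ k : ℕ, av (fun ρ : Fin m → α => (sampleSum Z ρ ^ (k + 1)).trace) =
      ∑ i, av (fun ρ : Fin m → α => (Z (ρ i) * sampleSum Z ρ ^ k).trace) := by
    intro k
    rw [← av_sum]
    congr 1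
    ext ρ
    rw [pow_succ', ← trace_sum, ← Matrix.sum_mul]
    rfl
  have h1 : av (fun ρ : Fin m → α => (sampleSum Z ρ ^ (n + 2)).trace) ≤
      (n + 1) * (κ * av (fun ρ : Fin m → α => (sampleSum Z ρ ^ (n + 1)).trace) +
        m * (2 * (κ + 1) * av (fun ρ : Fin m → α => (sampleSum Z ρ ^ n).trace))) := by
    rw [hsum (n + 1), hsum n]
    refine (sum_le_sum fun i _ => av_trace_sample_mul_pow_le hn hZ hZ0 hκ i).trans_eq ?_
    rw [← mul_sum, sum_add_distrib, ← mul_sum, sum_const, card_univ, Fintype.card_fin,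
      nsmul_eq_mul]
  have h2 : 2 * ((n + 1) * κ) * av (fun ρ : Fin m → α => (sampleSum Z ρ ^ (n + 1)).trace) ≤
      av (fun ρ : Fin m → α => (sampleSum Z ρ ^ (n + 2)).trace) +
        ((n + 1) * κ) ^ 2 * av (fun ρ : Fin m → α => (sampleSum Z ρ ^ n).trace) := by
    rw [← av_const_mul, ← av_const_mul, ← av_add]
    exact av_mono fun ρ => trace_pow_succ_le hn (sampleSum_transpose hZ ρ) _
  linarith

/-- Moment bound for sampled rank-one matrices in isotropic position. -/
lemma av_trace_pow_le {m q : ℕ} (y : α → ι → ℝ) {κ : ℝ} (hκ : 0 ≤ κ)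
    (hy : ∀ j, y j ⬝ᵥ y j ≤ κ)
    (hiso : ∑ j, (vecMulVec (y j) (y j) - 1) = 0) :
    av (fun ρ : Fin m → α => (sampleSum (fun j => vecMulVec (y j) (y j) - 1) ρ ^ (2 * q)).trace) ≤
      (4 * q ^ 2 * κ ^ 2 + 8 * q * (κ + 1) * m) ^ q * Fintype.card ι := by
  have hZ : ∀ j, (vecMulVec (y j) (y j) - 1 : Matrix ι ι ℝ)ᵀ = vecMulVec (y j) (y j) - 1 :=
    fun j => by rw [transpose_sub, transpose_vecMulVec, transpose_one]
  set B : ℝ := 4 * q ^ 2 * κ ^ 2 + 8 * q * (κ + 1) * m with hB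
  have hB0 : 0 ≤ B := by positivity
  have key : ∀ k ≤ q, av (fun ρ : Fin m → α =>
      (sampleSum (fun j => vecMulVec (y j) (y j) - 1) ρ ^ (2 * k)).trace) ≤
        B ^ k * Fintype.card ι := by
    intro k
    induction k with
    | zero => intro _; simp [av_const]
    | succ k ih =>
      intro hk
      have hkq : (k : ℝ) + 1 ≤ q := by exact_mod_cast hk
      have h1 := av_trace_pow_add_two_le (m := m) (even_two_mul k) hZ hiso (κ := κ)
        fun j X hX => trace_rankOne_sub_one_sq_le (even_two_mul k) (y j) (hy j) hX
      have h2 : (((2 * k : ℕ) : ℝ) + 1) ^ 2 * κ ^ 2 +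
          4 * (((2 * k : ℕ) : ℝ) + 1) * (κ + 1) * m ≤ B := by
        have h3 : ((2 * k : ℕ) : ℝ) + 1 ≤ 2 * q := by push_cast; linarith
        calc _ ≤ (2 * q : ℝ) ^ 2 * κ ^ 2 + 4 * (2 * q) * (κ + 1) * m := by gcongr
          _ = B := by rw [hB]; ring
      have h4 : 0 ≤ av (fun ρ : Fin m → α =>
          (sampleSum (fun j => vecMulVec (y j) (y j) - 1) ρ ^ (2 * k)).trace) := by
        refine div_nonneg (sum_nonneg fun ρ _ => ?_) (Nat.cast_nonneg _)
        have := trace_mul_mul_pow_nonneg (even_two_mul k) (sampleSum_transpose hZ ρ)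
          (transpose_one (n := ι) (α := ℝ))
        simpa using this
      calc _ ≤ _ := h1
        _ ≤ B * (B ^ k * Fintype.card ι) :=
          mul_le_mul h2 (ih (Nat.le_of_succ_le hk)) h4 hB0
        _ = _ := by ring
  exact key q le_rfl

/-- Sampling isotropic vectors gives a well-conditioned empirical second moment matrix. -/
lemma pr_sample_deviation_le {m q : ℕ} (y : α → ι → ℝ) {κ ε : ℝ} (hκ : 0 ≤ κ)
    (hy : ∀ j, y j ⬝ᵥ y j ≤ κ) (hiso : ∑ j, (vecMulVec (y j) (y j) - 1) = 0) (hε : 0 < ε)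
    (hm : 0 < m) :
    pr (fun ρ : Fin m → α => ¬ ∀ c : ι → ℝ, c ⬝ᵥ c = 1 →
      |(∑ i, (c ⬝ᵥ y (ρ i)) ^ 2) / m - 1| ≤ ε) ≤
      ((4 * q ^ 2 * κ ^ 2 + 8 * q * (κ + 1) * m) / (ε * m) ^ 2) ^ q * Fintype.card ι := by
  have hm' : (0 : ℝ) < m := by exact_mod_cast hm
  have hZ : ∀ j, (vecMulVec (y j) (y j) - 1 : Matrix ι ι ℝ)ᵀ = vecMulVec (y j) (y j) - 1 :=
    fun j => by rw [transpose_sub, transpose_vecMulVec, transpose_one]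
  set X := sampleSum (m := m) (fun j => vecMulVec (y j) (y j) - 1)
  have hquad : ∀ (ρ : Fin m → α) (c : ι → ℝ), c ⬝ᵥ c = 1 →
      c ⬝ᵥ X ρ *ᵥ c = m * ((∑ i, (c ⬝ᵥ y (ρ i)) ^ 2) / m - 1) := by
    intro ρ c hc
    simp only [X, sampleSum]
    rw [sum_mulVec, dotProduct_sum]
    simp only [sub_mulVec, one_mulVec, dotProduct_sub, hc, sum_sub_distrib]
    rw [mul_sub, mul_div_cancel₀ _ hm'.ne']
    simp only [vecMulVec_mulVec, sum_const, card_univ, Fintype.card_fin, nsmul_eq_mul]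
    congr 1
    refine sum_congr rfl fun i _ => ?_
    rw [dotProduct_smul, dotProduct_comm (y (ρ i)) c]
    simp [sq]
  have h0 : ∀ ρ, 0 ≤ (X ρ ^ (2 * q)).trace := fun ρ => by
    have := trace_mul_mul_pow_nonneg (even_two_mul q) (sampleSum_transpose hZ ρ)
      (transpose_one (n := ι) (α := ℝ))
    simpa using this
  have hεm : 0 < ε * m := by positivity
  calc _ ≤ av (fun ρ : Fin m → α => ((ε * m) ^ (2 * q))⁻¹ * (X ρ ^ (2 * q)).trace) := by
        refine pr_le_av (fun ρ => mul_nonneg (by positivity) (h0 ρ)) fun ρ hρ => ?_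
        push Not at hρ
        obtain ⟨c, hc, hdev⟩ := hρ
        rw [← div_eq_inv_mul, one_le_div (by positivity)]
        refine le_trans ?_ (quadForm_pow_le_trace (even_two_mul q) (sampleSum_transpose hZ ρ) hc)
        rw [hquad ρ c hc, ← (even_two_mul q).pow_abs ((m : ℝ) * _), abs_mul, abs_of_pos hm', mul_comm ε]
        exact pow_le_pow_left₀ (by positivity) (mul_le_mul_of_nonneg_left hdev.le hm'.le) _
    _ ≤ ((ε * m) ^ (2 * q))⁻¹ *
          ((4 * q ^ 2 * κ ^ 2 + 8 * q * (κ + 1) * m) ^ q * Fintype.card ι) := by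
        rw [av_const_mul]
        exact mul_le_mul_of_nonneg_left (av_trace_pow_le y hκ hy hiso) (by positivity)
    _ = _ := by rw [div_pow, pow_mul]; ring

end MomentBound

section LayerCake

/-- Discrete layer-cake approximation of `a ^ 2` from below with decreasing thresholds `t`. -/
noncomputable def layer (t : ℕ → ℝ) (K : ℕ) (a : ℝ) : ℝ :=
  ∑ k ∈ range (K + 1), (t k ^ 2 - t (k + 1) ^ 2) * if t k < a then 1 else 0

variable {t : ℕ → ℝ} {q : ℝ}

lemma layer_nonneg (ht0 : ∀ k, 0 < t k) (hta : Antitone t) (K : ℕ) (a : ℝ) :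
    0 ≤ layer t K a := by
  refine sum_nonneg fun k _ => mul_nonneg ?_ (by split_ifs <;> norm_num)
  exact sub_nonneg.mpr (pow_le_pow_left₀ (ht0 _).le (hta k.le_succ) 2)

lemma layer_eq_zero (hta : Antitone t) {K : ℕ} {a : ℝ} (h : a ≤ t K) : layer t K a = 0 := by
  refine sum_eq_zero fun k hk => ?_
  have : t K ≤ t k := hta (Nat.lt_succ_iff.mp (mem_range.mp hk))
  rw [if_neg (by linarith), mul_zero]

lemma layer_succ (K : ℕ) (a : ℝ) : layer t (K + 1) a = layer t K a +
    (t (K + 1) ^ 2 - t (K + 2) ^ 2) * if t (K + 1) < a then 1 else 0 := by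
  rw [layer, sum_range_succ]; rfl

lemma layer_le_sq (ht0 : ∀ k, 0 < t k) (hta : Antitone t) (K : ℕ) (a : ℝ) :
    layer t K a ≤ a ^ 2 := by
  have key : ∀ K, t K < a → layer t K a ≤ a ^ 2 - t (K + 1) ^ 2 := by
    intro K
    induction K with
    | zero =>
      intro h
      have := pow_le_pow_left₀ (ht0 0).le h.le 2
      simp [layer, h]; linarith
    | succ K ih =>
      intro h
      rw [layer_succ, if_pos h, mul_one]
      rcases lt_or_ge (t K) a with h' | h'
      · linarith [ih h']
      · have := pow_le_pow_left₀ (ht0 _).le h.le 2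
        rw [layer_eq_zero hta h']; linarith
  rcases lt_or_ge (t K) a with h | h
  · linarith [key K h, sq_nonneg (t (K + 1))]
  · rw [layer_eq_zero hta h]; positivity

lemma sq_le_layer (ht0 : ∀ k, 0 < t k) (hta : Antitone t) (htq : ∀ k, t k = q * t (k + 1))
    (K : ℕ) {a : ℝ} (ha : 0 ≤ a) (hat : a ≤ t 0) :
    a ^ 2 ≤ q ^ 2 * layer t K a + t K ^ 2 := by
  have hnn := fun K => layer_nonneg ht0 hta K a
  induction K with
  | zero =>
    have := pow_le_pow_left₀ ha hat 2
    nlinarith [mul_nonneg (sq_nonneg q) (hnn 0)]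
  | succ K ih =>
    rcases lt_or_ge (t (K + 1)) a with h | h
    · rw [layer_succ, if_pos h, mul_one]
      have h1 : t K ^ 2 = q ^ 2 * t (K + 1) ^ 2 := by rw [htq K, mul_pow]
      have h2 : t (K + 1) ^ 2 = q ^ 2 * t (K + 2) ^ 2 := by rw [htq (K + 1), mul_pow]
      nlinarith
    · have := pow_le_pow_left₀ ha h 2
      nlinarith [mul_nonneg (sq_nonneg q) (hnn (K + 1))]

lemma av_layer {I : Type*} [Fintype I] (K : ℕ) (a : I → ℝ) :
    av (fun i => layer t K (a i)) =
      ∑ k ∈ range (K + 1), (t k ^ 2 - t (k + 1) ^ 2) * pr (fun i => t k < a i) := by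
  simp only [layer, pr, av, mul_div_assoc', mul_sum, ← sum_div]
  rw [sum_comm]

/-- Tail comparison at all thresholds yields comparison of second moments. -/
lemma av_sq_le_of_tail {I J : Type*} [Fintype I] [Nonempty I] [Fintype J]
    (ht0 : ∀ k, 0 < t k) (hta : Antitone t) (htq : ∀ k, t k = q * t (k + 1)) (K : ℕ)
    (a : I → ℝ) (a' : J → ℝ) (ha : ∀ i, 0 ≤ a i) {v w A : ℝ} (hA : 0 ≤ A) (hv : 0 < v)
    (hw : 0 < w) (hat : ∀ i, a i ≤ v * t 0) (τ : ℕ → ℝ)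
    (htail : ∀ k ≤ K, pr (fun i => v * t k < a i) ≤ A * pr (fun j => w * t k < a' j) + τ k) :
    av (fun i => a i ^ 2) ≤ v ^ 2 * (q ^ 2 * (A * (av (fun j => a' j ^ 2) / w ^ 2) +
      ∑ k ∈ range (K + 1), (t k ^ 2 - t (k + 1) ^ 2) * τ k) + t K ^ 2) := by
  have hv2 : 0 < v ^ 2 := by positivity
  have h1 : av (fun i => a i ^ 2) = v ^ 2 * av (fun i => (a i / v) ^ 2) := by
    rw [← av_const_mul]; congr 1; ext i; field_simp
  have h2 : av (fun i => (a i / v) ^ 2) ≤ q ^ 2 * av (fun i => layer t K (a i / v)) + t K ^ 2 := by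
    rw [← av_const_mul, ← av_const (α := I) (t K ^ 2), ← av_add]
    exact av_mono fun i => sq_le_layer ht0 hta htq K (div_nonneg (ha i) hv.le)
      ((div_le_iff₀' hv).mpr (hat i))
  have h3 : av (fun i => layer t K (a i / v)) ≤ A * av (fun j => layer t K (a' j / w)) +
      ∑ k ∈ range (K + 1), (t k ^ 2 - t (k + 1) ^ 2) * τ k := by
    rw [av_layer, av_layer, mul_sum, ← sum_add_distrib]
    refine sum_le_sum fun k hk => ?_
    have hc : 0 ≤ t k ^ 2 - t (k + 1) ^ 2 :=
      sub_nonneg.mpr (pow_le_pow_left₀ (ht0 _).le (hta k.le_succ) 2)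
    have h := mul_le_mul_of_nonneg_left (htail k (Nat.lt_succ_iff.mp (mem_range.mp hk))) hc
    simp only [lt_div_iff₀' hv, lt_div_iff₀' hw]
    linarith
  have h4 : av (fun j => layer t K (a' j / w)) ≤ av (fun j => a' j ^ 2) / w ^ 2 := by
    rw [div_eq_inv_mul, ← av_const_mul]
    refine av_mono fun j => (layer_le_sq ht0 hta K _).trans_eq ?_
    rw [div_pow, div_eq_inv_mul]
  rw [h1]
  have hq : 0 ≤ q ^ 2 := sq_nonneg q
  gcongr
  refine h2.trans ?_
  gcongr
  refine h3.trans ?_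
  gcongr

end LayerCake

section RestrictedIsometry

/-- If two finite families have approximants with comparable tails, their second moments are
comparable. -/
lemma av_sq_close {I J : Type*} [Fintype I] [Nonempty I] [Fintype J] [Nonempty J]
    {t : ℕ → ℝ} {q : ℝ} (ht0 : ∀ k, 0 < t k) (hta : Antitone t)
    (htq : ∀ k, t k = q * t (k + 1)) (K : ℕ)
    {a : I → ℝ} {a' : J → ℝ} (ha : ∀ i, 0 ≤ a i) (ha' : ∀ j, 0 ≤ a' j)
    (hat : ∀ i, a i ≤ t 0) (hat' : ∀ j, a' j ≤ t 0)
    {b : ℕ → I → ℝ} {b' : ℕ → J → ℝ} {η : ℝ} (hη : 0 < η) (hη1 : η < 1)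
    (hb : ∀ k ≤ K, ∀ i, |b k i - a i| ≤ η * t k)
    (hb' : ∀ k ≤ K, ∀ j, |b' k j - a' j| ≤ η * t k) {τ : ℕ → ℝ}
    (h : ∀ k ≤ K, |pr (fun i => t k < b k i) - pr (fun j => t k < b' k j)| ≤
      η * pr (fun j => t k < b' k j) + τ k) :
    av (fun i => a i ^ 2) ≤ (1 + η) ^ 2 * (q ^ 2 * ((1 + η) * (av (fun j => a' j ^ 2) /
        (1 - η) ^ 2) + ∑ k ∈ range (K + 1), (t k ^ 2 - t (k + 1) ^ 2) * τ k) + t K ^ 2) ∧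
    av (fun j => a' j ^ 2) ≤ (1 + η) ^ 2 * (q ^ 2 * ((1 - η)⁻¹ * (av (fun i => a i ^ 2) /
        (1 - η) ^ 2) + ∑ k ∈ range (K + 1), (t k ^ 2 - t (k + 1) ^ 2) * ((1 - η)⁻¹ * τ k)) +
          t K ^ 2) := by
  have h1 : 0 < 1 - η := by linarith
  have up : ∀ k ≤ K, pr (fun i => (1 + η) * t k < a i) ≤ pr (fun i => t k < b k i) :=
    fun k hk => pr_mono fun i hi => by linarith [(abs_le.mp (hb k hk i)).1]
  have up' : ∀ k ≤ K, pr (fun i => (1 + η) * t k < a' i) ≤ pr (fun i => t k < b' k i) :=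
    fun k hk => pr_mono fun i hi => by linarith [(abs_le.mp (hb' k hk i)).1]
  have lo : ∀ k ≤ K, pr (fun i => t k < b k i) ≤ pr (fun i => (1 - η) * t k < a i) :=
    fun k hk => pr_mono fun i hi => by linarith [(abs_le.mp (hb k hk i)).2]
  have lo' : ∀ k ≤ K, pr (fun i => t k < b' k i) ≤ pr (fun i => (1 - η) * t k < a' i) :=
    fun k hk => pr_mono fun i hi => by linarith [(abs_le.mp (hb' k hk i)).2]
  have hbig : ∀ x, x ≤ t 0 → x ≤ (1 + η) * t 0 := fun x hx => by nlinarith [ht0 0]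
  constructor
  · refine av_sq_le_of_tail ht0 hta htq K a a' ha (by linarith) (by linarith) h1
      (fun i => hbig _ (hat i)) τ fun k hk => ?_
    have := (abs_le.mp (h k hk)).2
    nlinarith [up k hk, lo' k hk]
  · refine av_sq_le_of_tail ht0 hta htq K a' a ha' (by positivity) (by linarith) h1
      (fun i => hbig _ (hat' i)) (fun k => (1 - η)⁻¹ * τ k) fun k hk => ?_
    have := (abs_le.mp (h k hk)).1
    rw [← mul_add, ← div_eq_inv_mul, le_div_iff₀' h1]
    nlinarith [lo k hk, up' k hk]

/-- The empirical combination of coordinate functionals encoded by a list of signed indices. -/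
noncomputable def emp {α κ : Type*} (g : α → κ → ℝ) (R : ℝ) {n : ℕ} (f : Fin n → κ × Bool)
    (j : α) : ℝ := |R / n * ∑ l, sgn (f l).2 * g j (f l).1|

lemma pr_bad_count_le {α κ : Type*} [Fintype α] [Nonempty α] [Fintype κ] (g : α → κ → ℝ) (R : ℝ)
    {m : ℕ} (hm : 0 < m) {η : ℝ} (hη : 0 < η) (hη1 : η ≤ 1) (t τ : ℕ → ℝ) (n : ℕ → ℕ) (K : ℕ) :
    pr (fun ρ : Fin m → α => ∃ k : Fin (K + 1), ∃ f : Fin (n k) → κ × Bool,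
      η * pr (fun j => t k < emp g R f j) + τ k <
      |pr (fun i => t k < emp g R f (ρ i)) - pr (fun j => t k < emp g R f j)|) ≤
    ∑ k : Fin (K + 1), ((2 * Fintype.card κ : ℝ) ^ n k * (2 * Real.exp (-(η * τ k * m)))) := by
  refine (pr_exists_le _).trans (sum_le_sum fun k _ => ?_)
  refine (pr_exists_le _).trans ?_
  have hm' : (0 : ℝ) < m := by exact_mod_cast hm
  have key : ∀ f : Fin (n k) → κ × Bool, pr (fun ρ : Fin m → α =>
      η * pr (fun j => t k < emp g R f j) + τ k <
      |pr (fun i => t k < emp g R f (ρ i)) - pr (fun j => t k < emp g R f j)|) ≤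
      2 * Real.exp (-(η * τ k * m)) := by
    intro f
    have h1 := pr_count_le m (fun j => t k < emp g R f j) (τ := τ k) (σ := 1) hη.le hη1 (by simp)
    have h2 := pr_count_le m (fun j => t k < emp g R f j) (τ := τ k) (σ := -1) hη.le hη1 (by simp)
    rw [two_mul]
    refine le_trans ?_ ((pr_or_le _ _).trans (add_le_add h1 h2))
    refine pr_mono fun ρ hρ => ?_
    have h3 : (∑ i, if t k < emp g R f (ρ i) then (1 : ℝ) else 0) =
        m * pr (fun i => t k < emp g R f (ρ i)) := by
      simp only [pr, av, Fintype.card_fin]; field_simp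
    rw [h3]
    rcases lt_abs.mp hρ with h | h
    · left; nlinarith [mul_le_mul_of_nonneg_left h.le hm'.le]
    · right; nlinarith [mul_le_mul_of_nonneg_left h.le hm'.le]
  refine (sum_le_sum fun f _ => key f).trans_eq ?_
  simp [mul_comm]

end RestrictedIsometry

section RestrictedIsometryBound

/-- Geometric thresholds. -/
noncomputable def thr (R : ℝ) (k : ℕ) : ℝ := 2 * R * Real.exp (-(k / 100))

lemma thr_pos {R : ℝ} (hR : 0 < R) (k : ℕ) : 0 < thr R k := by unfold thr; positivity

lemma thr_eq (R : ℝ) (k : ℕ) : thr R k = Real.exp (1 / 100) * thr R (k + 1) := by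
  unfold thr
  rw [mul_left_comm, ← Real.exp_add]
  push_cast
  ring_nf

lemma thr_antitone {R : ℝ} (hR : 0 < R) : Antitone (thr R) := by
  refine antitone_nat_of_succ_le fun k => ?_
  rw [thr_eq R k]
  have := thr_pos hR (k + 1)
  nlinarith [Real.add_one_le_exp (1 / 100 : ℝ)]

lemma thr_le {R : ℝ} (hR : 0 < R) (k : ℕ) : thr R k ≤ 2 * R :=
  (thr_antitone hR (Nat.zero_le k)).trans_eq (by simp [thr])

lemma exp_hundredth_sq_le : Real.exp (1 / 100) ^ 2 ≤ 10204 / 10000 := by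
  rw [← Real.exp_nat_mul]
  have := (abs_le.mp (Real.abs_exp_sub_one_sub_id_le (x := 2 * (1 / 100)) (by norm_num))).2
  push_cast
  linarith

lemma thr_sq_sub_le {R : ℝ} (k : ℕ) :
    thr R k ^ 2 - thr R (k + 1) ^ 2 ≤ thr R k ^ 2 / 50 := by
  have h : thr R (k + 1) = Real.exp (-(1 / 100)) * thr R k := by
    rw [thr_eq R k, ← mul_assoc, ← Real.exp_add]; simp
  have h2 : 49 / 50 ≤ Real.exp (-(1 / 100)) ^ 2 := by
    rw [← Real.exp_nat_mul]
    have := Real.add_one_le_exp ((2 : ℕ) * -(1 / 100 : ℝ))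
    push_cast at this ⊢
    linarith
  rw [h, mul_pow]
  nlinarith [sq_nonneg (thr R k)]

lemma sum_abs_le_sqrt {κ : Type*} [Fintype κ] {x : κ → ℝ} {S : ℕ}
    (hS : (univ.filter fun k => x k ≠ 0).card ≤ S) (hx : ∑ k, x k ^ 2 = 1) :
    ∑ k, |x k| ≤ Real.sqrt S := by
  refine Real.le_sqrt_of_sq_le ?_
  have h1 : ∑ k, |x k| = ∑ k ∈ univ.filter (fun k => x k ≠ 0), |x k| := by
    rw [sum_filter]
    refine sum_congr rfl fun k _ => ?_
    by_cases h : x k = 0 <;> simp [h]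
  rw [h1]
  refine sq_sum_le_card_mul_sum_sq.trans ?_
  have h2 : ∑ k ∈ univ.filter (fun k => x k ≠ 0), |x k| ^ 2 ≤ 1 := by
    rw [← hx]
    refine (sum_le_sum_of_subset_of_nonneg (filter_subset _ _) fun _ _ _ => sq_nonneg _).trans_eq ?_
    simp
  have h3 : ((univ.filter fun k => x k ≠ 0).card : ℝ) ≤ S := by exact_mod_cast hS
  nlinarith [sum_nonneg fun k (_ : k ∈ univ.filter (fun k => x k ≠ 0)) => sq_nonneg |x k|]

lemma abs_sub_one_le {X W Q T : ℝ} (hX : 0 ≤ X) (hW0 : 0 ≤ W) (hW : W ≤ 1 / 1000)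
    (hQ : Q ≤ 10204 / 10000) (hT : T ≤ 1 / 100)
    (hup : X ≤ (1 + 1 / 100) ^ 2 * (Q * ((1 + 1 / 100) * (1 / (1 - 1 / 100) ^ 2) + W) + T))
    (hlo : 1 ≤ (1 + 1 / 100) ^ 2 *
      (Q * ((1 - 1 / 100)⁻¹ * (X / (1 - 1 / 100) ^ 2) + 100 / 99 * W) + T)) :
    |X - 1| ≤ 1 / 10 := by
  have h1 := mul_le_mul_of_nonneg_right hQ hX
  have h2 := mul_le_mul_of_nonneg_right hQ hW0
  norm_num at hup hlo
  rw [abs_le]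
  constructor <;> linarith

lemma union_sum_le {N m K : ℕ} (hN : 0 < N) {L p : ℝ} (hL : 1 ≤ L) (hNL : 4 * N ≤ Real.exp L)
    (hp : 0 < p) (hpL : 2 / p ≤ Real.exp L) (hKL : (K : ℝ) + 1 ≤ 102 * L) {n : ℕ → ℕ}
    {τ : ℕ → ℝ} (s : ℕ → ℝ) (hs : ∀ k, L / 4 ≤ s k) (hn : ∀ k, (n k : ℝ) ≤ 32 * 10 ^ 4 * s k)
    (hτ : ∀ k, 1 / 100 * τ k * m = 64 * 10 ^ 4 * s k * L) :
    ∑ k : Fin (K + 1), ((2 * Fintype.card (Fin N) : ℝ) ^ n k *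
      (2 * Real.exp (-(1 / 100 * τ k * m)))) ≤ p := by
  have hterm : ∀ k : Fin (K + 1), (2 * Fintype.card (Fin N) : ℝ) ^ n k *
      (2 * Real.exp (-(1 / 100 * τ k * m))) ≤ 2 * Real.exp (-(80000 * L ^ 2)) := by
    intro k
    have hN' : (1 : ℝ) ≤ N := by exact_mod_cast hN
    have h1 : (2 * Fintype.card (Fin N) : ℝ) ^ n k ≤ Real.exp (n k * L) := by
      rw [Real.exp_nat_mul, Fintype.card_fin]
      exact pow_le_pow_left₀ (by positivity) (by linarith) _
    rw [hτ]
    refine (mul_le_mul_of_nonneg_right h1 (by positivity)).trans ?_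
    rw [mul_left_comm, ← Real.exp_add]
    refine mul_le_mul_of_nonneg_left (Real.exp_le_exp.mpr ?_) (by norm_num)
    nlinarith [hn k, hs k]
  refine (sum_le_sum fun k _ => hterm k).trans ?_
  rw [sum_const, card_univ, Fintype.card_fin, nsmul_eq_mul]
  have h1 : ((K + 1 : ℕ) : ℝ) ≤ Real.exp (102 * L) := by
    push_cast
    linarith [Real.add_one_le_exp (102 * L)]
  calc _ ≤ Real.exp (102 * L) * (2 * Real.exp (-(80000 * L ^ 2))) :=
        mul_le_mul_of_nonneg_right h1 (by positivity)
    _ = 2 * Real.exp (102 * L - 80000 * L ^ 2) := by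
        rw [mul_left_comm, ← Real.exp_add]; rfl
    _ ≤ 2 * Real.exp (-L) := by
        refine mul_le_mul_of_nonneg_left (Real.exp_le_exp.mpr ?_) (by norm_num)
        nlinarith
    _ ≤ p := by
        rw [Real.exp_neg, ← div_eq_mul_inv, div_le_iff₀ (Real.exp_pos _)]
        rwa [div_le_iff₀ hp, mul_comm] at hpL

/-- Rows drawn uniformly from a bounded orthonormal system form a restricted isometry. -/
theorem pr_not_rip_le {N : ℕ} (hN : 0 < N) (g : Fin N → Fin N → ℝ) (hg : ∀ j k, |g j k| ≤ 1)
    (hiso : ∀ x : Fin N → ℝ, ∑ j, (∑ k, g j k * x k) ^ 2 = N * ∑ k, x k ^ 2)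
    {S m : ℕ} (hS : 1 ≤ S) {L p : ℝ} (hL : 1 ≤ L) (hNL : 4 * N ≤ Real.exp L)
    (hSL : 20 * Real.sqrt S ≤ Real.exp L) (hp : 0 < p) (hpL : 2 / p ≤ Real.exp L)
    (hm : 10 ^ 12 * S * L ^ 3 ≤ m) :
    pr (fun ρ : Fin m → Fin N => ¬ ∀ x : Fin N → ℝ, (univ.filter fun k => x k ≠ 0).card ≤ S →
      ∑ k, x k ^ 2 = 1 → |(∑ i, (∑ k, g (ρ i) k * x k) ^ 2) / m - 1| ≤ 1 / 10) ≤ p := by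
  have : NeZero N := ⟨hN.ne'⟩
  have hS' : (1 : ℝ) ≤ S := by exact_mod_cast hS
  have hm0' : (0 : ℝ) < m := lt_of_lt_of_le (by positivity) hm
  have hm0 : 0 < m := by exact_mod_cast hm0'
  have : NeZero m := ⟨hm0.ne'⟩
  set R := Real.sqrt S with hRdef
  have hR2 : R ^ 2 = S := Real.sq_sqrt (by linarith)
  have hR1 : 1 ≤ R := by rw [hRdef]; exact Real.one_le_sqrt.mpr hS'
  have hR : 0 < R := by linarith
  set t := thr R with ht
  have ht0 : ∀ k, 0 < t k := thr_pos hR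
  have ht2 : ∀ k, t k ^ 2 ≤ 4 * S := fun k => by
    rw [← hR2]; nlinarith [thr_le hR k, ht0 k]
  set A : ℝ := 64 * 10 ^ 6 * S * L ^ 2 / m with hA
  set τ : ℕ → ℝ := fun k => A / t k ^ 2 with hτ
  set n : ℕ → ℕ := fun k => ⌈16 * 10 ^ 4 * S * L / t k ^ 2⌉₊ with hn
  set K : ℕ := ⌈100 * Real.log (20 * R)⌉₊ with hK
  have hlog : Real.log (20 * R) ≤ L := by
    rw [Real.log_le_iff_le_exp (by positivity)]; exact hSL
  have hKL : (K : ℝ) + 1 ≤ 102 * L := by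
    have h0 : 0 ≤ Real.log (20 * R) := Real.log_nonneg (by linarith)
    have := Nat.ceil_lt_add_one (show 0 ≤ 100 * Real.log (20 * R) by positivity)
    linarith
  have htK : t K ≤ 1 / 10 := by
    have h1 : 100 * Real.log (20 * R) ≤ K := Nat.le_ceil _
    have h2 : Real.exp (-(K / 100 : ℝ)) ≤ (20 * R)⁻¹ := by
      rw [← Real.exp_log (show 0 < 20 * R by positivity), ← Real.exp_neg]
      exact Real.exp_le_exp.mpr (by linarith)
    calc t K ≤ 2 * R * (20 * R)⁻¹ := mul_le_mul_of_nonneg_left h2 (by positivity)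
      _ = 1 / 10 := by field_simp; norm_num
  have hn1 : ∀ k, 16 * 10 ^ 4 * S * L / t k ^ 2 ≤ n k := fun k => Nat.le_ceil _
  have hquot : ∀ k, L / 4 ≤ S * L / t k ^ 2 := fun k => by
    rw [le_div_iff₀ (pow_pos (ht0 k) 2)]
    nlinarith [ht2 k]
  have hn2 : ∀ k, (n k : ℝ) ≤ 32 * 10 ^ 4 * (S * L / t k ^ 2) := fun k => by
    have h0 : (0 : ℝ) ≤ 16 * 10 ^ 4 * S * L / t k ^ 2 := by positivity
    have h1 := Nat.ceil_lt_add_one h0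
    have h2 : 16 * 10 ^ 4 * S * L / t k ^ 2 = 16 * 10 ^ 4 * (S * L / t k ^ 2) := by ring
    rw [h2] at h1
    have h3 := hquot k
    have h4 : (n k : ℝ) < 16 * 10 ^ 4 * (S * L / t k ^ 2) + 1 := by rw [← h2] at h1 ⊢; exact h1
    linarith
  have hn0 : ∀ k, 0 < n k := fun k => Nat.ceil_pos.mpr (by have := ht0 k; positivity)
  have hmaurey : ∀ k, 2 * (Fintype.card (Fin N) : ℝ) *
      Real.exp (-(n k * (1 / 100 * t k) ^ 2 / (16 * R ^ 2))) < 1 := by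
    intro k
    have h1 : L ≤ n k * (1 / 100 * t k) ^ 2 / (16 * R ^ 2) := by
      rw [le_div_iff₀ (by positivity), hR2]
      have := (div_le_iff₀ (pow_pos (ht0 k) 2)).mp (hn1 k)
      nlinarith
    have h2 : Real.exp (-(n k * (1 / 100 * t k) ^ 2 / (16 * R ^ 2))) ≤ (4 * (N : ℝ))⁻¹ := by
      refine (Real.exp_le_exp.mpr (neg_le_neg h1)).trans ?_
      rw [Real.exp_neg]
      exact inv_anti₀ (by positivity) hNL
    have hN' : (0 : ℝ) < N := by exact_mod_cast hN
    calc _ ≤ 2 * (N : ℝ) * (4 * (N : ℝ))⁻¹ := by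
          rw [Fintype.card_fin]; exact mul_le_mul_of_nonneg_left h2 (by positivity)
      _ = 1 / 2 := by field_simp; norm_num
      _ < 1 := by norm_num
  refine le_trans (pr_mono fun ρ hρ => ?_) ((pr_bad_count_le g R hm0 (η := 1 / 100)
    (by norm_num) (by norm_num) t τ n K).trans ?_)
  · by_contra hgood
    push Not at hgood
    refine hρ fun x hxS hx1 => ?_
    have hl1 : ∑ k, |x k| ≤ R := sum_abs_le_sqrt hxS hx1
    choose f hf using fun k => exists_sparse_approx g hg x hR hl1
      (u := 1 / 100 * t k) (by have := ht0 k; positivity)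
      (by linarith [thr_le hR k]) (hn0 k) (hmaurey k)
    have hbd : ∀ j, |∑ k, g j k * x k| ≤ t 0 := fun j => by
      have : |∑ k, g j k * x k| ≤ ∑ k, |x k| :=
        (abs_sum_le_sum_abs _ _).trans (sum_le_sum fun k _ => by
          rw [abs_mul]; exact mul_le_of_le_one_left (abs_nonneg _) (hg j k))
      have h0 : t 0 = 2 * R := by simp [ht, thr]
      linarith
    have happ : ∀ k j, |emp g R (f k) j - (|∑ k, g j k * x k|)| ≤ 1 / 100 * t k := fun k j =>
      (abs_abs_sub_abs_le _ _).trans (hf k j)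
    obtain ⟨hup, hlo⟩ := av_sq_close ht0 (thr_antitone hR) (thr_eq R) K
      (a := fun i => |∑ k, g (ρ i) k * x k|) (a' := fun j => |∑ k, g j k * x k|)
      (fun _ => abs_nonneg _) (fun _ => abs_nonneg _) (fun _ => hbd _) hbd
      (b := fun k i => emp g R (f k) (ρ i)) (b' := fun k j => emp g R (f k) j)
      (η := 1 / 100) (by norm_num) (by norm_num) (fun k _ i => happ k (ρ i))
      (fun k _ j => happ k j) (τ := τ)
      (fun k hk => hgood ⟨k, Nat.lt_succ_of_le hk⟩ (f k))
    simp only [sq_abs] at hup hlo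
    have hJ : av (fun j => (∑ k, g j k * x k) ^ 2) = 1 := by
      have hN' : (N : ℝ) ≠ 0 := by exact_mod_cast hN.ne'
      rw [av, hiso, hx1, Fintype.card_fin, mul_one, div_self hN']
    have hI : av (fun i => (∑ k, g (ρ i) k * x k) ^ 2) =
        (∑ i, (∑ k, g (ρ i) k * x k) ^ 2) / m := by rw [av, Fintype.card_fin]
    rw [hJ, hI] at hup hlo
    have hsum : ∑ k ∈ range (K + 1), (t k ^ 2 - t (k + 1) ^ 2) * τ k ≤ 1 / 1000 := by
      calc _ ≤ ∑ k ∈ range (K + 1), A / 50 := by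
            refine sum_le_sum fun k _ => ?_
            have h1 : 0 ≤ τ k := by positivity
            refine (mul_le_mul_of_nonneg_right (thr_sq_sub_le k) h1).trans_eq ?_
            simp only [hτ]
            have := (ht0 k).ne'
            rw [← ht]
            field_simp
        _ = (K + 1) * (A / 50) := by simp
        _ ≤ 102 * L * (A / 50) := mul_le_mul_of_nonneg_right hKL (by positivity)
        _ ≤ 1 / 1000 := by
            rw [hA]
            have : 102 * L * (64 * 10 ^ 6 * S * L ^ 2 / m / 50) =
              (102 * 64 * 10 ^ 6 / 50 * (S * L ^ 3)) / m := by field_simp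
            rw [this, div_le_iff₀ hm0']
            have : 0 ≤ S * L ^ 3 := by positivity
            linarith
    have hsum0 : ∑ k ∈ range (K + 1), (t k ^ 2 - t (k + 1) ^ 2) * ((1 - 1 / 100 : ℝ)⁻¹ * τ k) =
        100 / 99 * ∑ k ∈ range (K + 1), (t k ^ 2 - t (k + 1) ^ 2) * τ k := by
      rw [mul_sum]
      refine sum_congr rfl fun k _ => ?_
      norm_num
      ring
    rw [hsum0] at hlo
    refine abs_sub_one_le (by positivity) (sum_nonneg fun k _ => mul_nonneg
      (sub_nonneg.mpr (pow_le_pow_left₀ (ht0 _).le (thr_antitone hR k.le_succ) 2))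
      (by positivity)) hsum exp_hundredth_sq_le ?_ hup hlo
    nlinarith [ht0 K]
  · refine union_sum_le hN (τ := τ) hL hNL hp hpL hKL (fun k => S * L / t k ^ 2) hquot hn2
      fun k => ?_
    simp only [hτ, hA]
    have := (ht0 k).ne'
    field_simp
    norm_num

end RestrictedIsometryBound

section Subspace

/-- The normalised energy of the sampled coordinates of the randomly signed transform of `x`. -/
noncomputable def energy {N m : ℕ} (g : Fin N → Fin N → ℝ)
    (ω : (Fin m → Fin N) × (Fin N → Bool)) (x : Fin N → ℝ) : ℝ :=
  (∑ i, (∑ k, g (ω.1 i) k * (sgn (ω.2 k) * x k)) ^ 2) / m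

lemma av_exp_sign_sum_le {N : ℕ} {a : Fin N → ℝ} (ha : ∑ k, a k ^ 2 ≤ 1) (c : ℝ) :
    av (fun δ : Fin N → Bool => Real.exp (c * ∑ k, a k * sgn (δ k))) ≤ Real.exp (c ^ 2 / 2) := by
  have h1 : av (fun δ : Fin N → Bool => Real.exp (c * ∑ k, a k * sgn (δ k))) =
      ∏ k, Real.cosh (c * a k) := by
    have h2 : ∀ k, Real.cosh (c * a k) = (∑ b : Bool, Real.exp (c * (a k * sgn b))) / 2 := by
      intro k
      simp [Real.cosh_eq, sgn]
    simp only [h2, prod_div_distrib, prod_univ_sum, Fintype.piFinset_univ]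
    simp [av, mul_sum, Real.exp_sum]
  rw [h1]
  calc _ ≤ ∏ k, Real.exp ((c * a k) ^ 2 / 2) :=
        prod_le_prod (fun k _ => (Real.cosh_pos _).le) fun k _ => Real.cosh_le_exp_half_sq _
    _ = Real.exp (c ^ 2 / 2 * ∑ k, a k ^ 2) := by
        rw [← Real.exp_sum, mul_sum]
        congr 1
        exact sum_congr rfl fun k _ => by ring
    _ ≤ _ := Real.exp_le_exp.mpr (mul_le_of_le_one_right (by positivity) ha)

lemma pr_sign_sum_gt_le {N : ℕ} {a : Fin N → ℝ} (ha : ∑ k, a k ^ 2 ≤ 1) {t : ℝ} (ht : 0 ≤ t) :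
    pr (fun δ : Fin N → Bool => t < |∑ k, a k * sgn (δ k)|) ≤ 2 * Real.exp (-(t ^ 2 / 2)) := by
  calc _ ≤ av (fun δ : Fin N → Bool =>
          Real.exp (-(t * t)) * Real.exp (t * ∑ k, a k * sgn (δ k)) +
          Real.exp (-(t * t)) * Real.exp (-t * ∑ k, a k * sgn (δ k))) := by
        refine pr_le_av (fun δ => by positivity) fun δ hδ => ?_
        have := two_mul_le_exp_add hδ ht
        rwa [add_comm (t * _), add_comm (-t * _), Real.exp_add, Real.exp_add] at this
    _ ≤ Real.exp (-(t * t)) * Real.exp (t ^ 2 / 2) +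
          Real.exp (-(t * t)) * Real.exp ((-t) ^ 2 / 2) := by
        rw [av_add, av_const_mul, av_const_mul]
        gcongr <;> exact av_exp_sign_sum_le ha _
    _ = _ := by
        rw [neg_sq, ← two_mul, ← Real.exp_add]
        congr 2
        ring

variable {ι : Type*} [Fintype ι]

/-- Random signs flatten the coordinates of a family of unit vectors in a bounded basis. -/
lemma pr_not_flat_le {N : ℕ} {g : Fin N → Fin N → ℝ} (hg : ∀ j k, |g j k| ≤ 1)
    {w : ι → Fin N → ℝ} (hw : ∀ i, ∑ k, w i k ^ 2 = 1) {l κ : ℝ} (hl : 0 ≤ l)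
    (hκ : 2 * l * Fintype.card ι ≤ κ) :
    pr (fun δ : Fin N → Bool => ¬ ∀ j, ∑ i, (∑ k, g j k * (sgn (δ k) * w i k)) ^ 2 ≤ κ) ≤
      2 * N * Fintype.card ι * Real.exp (-l) := by
  have hone : ∀ x : Fin N × ι, pr (fun δ : Fin N → Bool =>
      √(2 * l) < |∑ k, g x.1 k * w x.2 k * sgn (δ k)|) ≤ 2 * Real.exp (-l) := by
    rintro ⟨j, i⟩
    have h1 : ∑ k, (g j k * w i k) ^ 2 ≤ 1 := by
      rw [← hw i]
      refine sum_le_sum fun k _ => ?_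
      rw [mul_pow]
      exact mul_le_of_le_one_left (sq_nonneg _) ((sq_le_one_iff_abs_le_one _).mpr (hg j k))
    have := pr_sign_sum_gt_le h1 (Real.sqrt_nonneg (2 * l))
    rwa [Real.sq_sqrt (by positivity), mul_div_cancel_left₀ _ (two_ne_zero)] at this
  calc _ ≤ pr (fun δ : Fin N → Bool =>
          ∃ x : Fin N × ι, √(2 * l) < |∑ k, g x.1 k * w x.2 k * sgn (δ k)|) := by
        refine pr_mono fun δ hδ => ?_
        contrapose! hδ
        intro j
        calc _ ≤ ∑ _i : ι, 2 * l := by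
              refine sum_le_sum fun i _ => ?_
              have h1 := hδ (j, i)
              have h2 : ∑ k, g j k * (sgn (δ k) * w i k) = ∑ k, g j k * w i k * sgn (δ k) :=
                sum_congr rfl fun k _ => by ring
              rw [h2, ← sq_abs, ← Real.sq_sqrt (by positivity : 0 ≤ 2 * l)]
              exact pow_le_pow_left₀ (abs_nonneg _) h1 2
          _ = 2 * l * Fintype.card ι := by simp [mul_comm]
          _ ≤ κ := hκ
    _ ≤ ∑ _x : Fin N × ι, 2 * Real.exp (-l) :=
        (pr_exists_le _).trans (sum_le_sum fun x _ => hone x)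
    _ = _ := by
        simp only [sum_const, card_univ, Fintype.card_prod, Fintype.card_fin, nsmul_eq_mul]
        push_cast
        ring

lemma sum_signed_mul_signed {N : ℕ} {g : Fin N → Fin N → ℝ}
    (hg : ∀ k l, ∑ j, g j k * g j l = if k = l then (N : ℝ) else 0) (δ : Fin N → Bool)
    (x y : Fin N → ℝ) :
    ∑ j, (∑ k, g j k * (sgn (δ k) * x k)) * (∑ k, g j k * (sgn (δ k) * y k)) =
      N * ∑ k, x k * y k := by
  calc _ = ∑ k, ∑ l, (sgn (δ k) * x k * (sgn (δ l) * y l)) * ∑ j, g j k * g j l := by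
        simp only [sum_mul_sum]
        simp only [mul_sum]
        rw [sum_comm]
        refine sum_congr rfl fun k _ => ?_
        rw [sum_comm]
        exact sum_congr rfl fun l _ => sum_congr rfl fun j _ => by ring
    _ = ∑ k, (sgn (δ k) * sgn (δ k)) * (N * (x k * y k)) := by
        refine sum_congr rfl fun k _ => ?_
        simp only [hg, mul_ite, mul_zero, sum_ite_eq, mem_univ, if_true]
        ring
    _ = _ := by simp only [sgn_mul_self, one_mul, mul_sum]

/-- Randomly signed and subsampled bounded orthogonal transforms nearly preserve norms on a
subspace given by an orthonormal basis. -/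
lemma pr_not_orthonormal_le {N m q : ℕ} (hm : 0 < m) (hN : 0 < N) {g : Fin N → Fin N → ℝ}
    (hg : ∀ j k, |g j k| ≤ 1)
    (hg2 : ∀ k l, ∑ j, g j k * g j l = if k = l then (N : ℝ) else 0)
    {w : ι → Fin N → ℝ} (hw : ∀ a b, ∑ k, w a k * w b k = if a = b then 1 else 0)
    {l κ ε : ℝ} (hl : 0 ≤ l) (hκ : 2 * l * Fintype.card ι ≤ κ) (hε : 0 < ε) :
    pr (fun ω : (Fin m → Fin N) × (Fin N → Bool) => ¬ ∀ c : ι → ℝ, ∑ i, c i ^ 2 = 1 →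
      |energy g ω (fun k => ∑ i, c i * w i k) - 1| ≤ ε) ≤
      2 * N * Fintype.card ι * Real.exp (-l) +
      ((4 * q ^ 2 * κ ^ 2 + 8 * q * (κ + 1) * m) / (ε * m) ^ 2) ^ q * Fintype.card ι := by
  have : Nonempty (Fin N) := ⟨⟨0, hN⟩⟩
  have hκ0 : 0 ≤ κ := le_trans (by positivity) hκ
  have hw1 : ∀ i, ∑ k, w i k ^ 2 = 1 := fun i => by
    have := hw i i
    simpa [← sq] using this
  refine (pr_prod_le (G := fun δ : Fin N → Bool =>
      ∀ j, ∑ i, (∑ k, g j k * (sgn (δ k) * w i k)) ^ 2 ≤ κ) ?_ ?_).trans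
    (add_le_add_left (pr_not_flat_le hg hw1 hl hκ) _)
  · positivity
  · intro δ hδ
    set y : Fin N → ι → ℝ := fun j i => ∑ k, g j k * (sgn (δ k) * w i k) with hy
    have hiso : ∑ j, (Matrix.vecMulVec (y j) (y j) - 1) = 0 := by
      ext a b
      rw [sum_sub_distrib, Matrix.sub_apply, Matrix.sum_apply, Matrix.sum_apply]
      simp only [Matrix.vecMulVec_apply, hy]
      rw [sum_signed_mul_signed hg2, hw]
      simp [Matrix.one_apply]
    have := pr_sample_deviation_le (m := m) (q := q) y hκ0 (fun j => by
      simpa [dotProduct, sq] using hδ j) hiso hε hm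
    refine le_trans (pr_mono fun ρ hρ => ?_) this
    contrapose! hρ
    intro c hc
    have h1 := hρ c (by simpa [dotProduct, sq] using hc)
    have h2 : ∀ i, ∑ k, g (ρ i) k * (sgn (δ k) * ∑ a, c a * w a k) = c ⬝ᵥ y (ρ i) := by
      intro i
      simp only [dotProduct, hy, mul_sum]
      rw [sum_comm]
      exact sum_congr rfl fun a _ => sum_congr rfl fun k _ => by ring
    simpa only [energy, h2] using h1

lemma exists_orthonormal_span {N : ℕ} (f : ι → Fin N → ℝ) :
    ∃ d ≤ Fintype.card ι, d ≤ N ∧ ∃ w : Fin d → Fin N → ℝ,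
      (∀ a b, ∑ k, w a k * w b k = if a = b then 1 else 0) ∧
      ∀ b : ι → ℝ, ∃ c : Fin d → ℝ, (fun k => ∑ i, b i * f i k) = fun k => ∑ i, c i * w i k := by
  set F : ι → EuclideanSpace ℝ (Fin N) := fun i => WithLp.toLp 2 (f i) with hF
  set S := Submodule.span ℝ (Set.range F) with hS
  let B := stdOrthonormalBasis ℝ S
  refine ⟨Module.finrank ℝ S, finrank_range_le_card F, ?_, fun a k => (B a : EuclideanSpace ℝ _) k,
    ?_, ?_⟩
  · simpa using Submodule.finrank_le S
  · intro a b
    have := orthonormal_iff_ite.mp B.orthonormal b a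
    rw [Submodule.coe_inner, PiLp.inner_apply] at this
    simpa [eq_comm] using this
  · intro b
    have hmem : ∑ i, b i • F i ∈ S :=
      Submodule.sum_mem _ fun i _ => Submodule.smul_mem _ _ (Submodule.subset_span ⟨i, rfl⟩)
    refine ⟨fun i => B.repr ⟨_, hmem⟩ i, ?_⟩
    ext k
    have := congrArg (fun x : S => (x : EuclideanSpace ℝ (Fin N)) k) (B.sum_repr ⟨_, hmem⟩)
    simpa [hF] using this.symm

end Subspace

section Combination

variable {ι : Type*} [Fintype ι]

lemma energy_smul {N m : ℕ} (g : Fin N → Fin N → ℝ) (ω : (Fin m → Fin N) × (Fin N → Bool))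
    (t : ℝ) (x : Fin N → ℝ) : energy g ω (t • x) = t ^ 2 * energy g ω x := by
  have : ∀ i, ∑ k, g (ω.1 i) k * (sgn (ω.2 k) * (t • x) k) =
      t * ∑ k, g (ω.1 i) k * (sgn (ω.2 k) * x k) := by
    intro i
    rw [mul_sum]
    refine sum_congr rfl fun k _ => ?_
    rw [Pi.smul_apply, smul_eq_mul]
    ring
  simp only [energy, this, mul_pow, ← mul_sum, mul_div_assoc]

lemma energy_zero {N m : ℕ} (g : Fin N → Fin N → ℝ) (ω : (Fin m → Fin N) × (Fin N → Bool)) :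
    energy g ω 0 = 0 := by
  simp [energy]

lemma abs_energy_sub_le_of_unit {N m : ℕ} {g : Fin N → Fin N → ℝ}
    {ω : (Fin m → Fin N) × (Fin N → Bool)} {ε : ℝ} (x : Fin N → ℝ)
    (h : ∀ t : ℝ, t ≠ 0 → ∑ k, (t • x) k ^ 2 = 1 → |energy g ω (t • x) - 1| ≤ ε) :
    |energy g ω x - ∑ k, x k ^ 2| ≤ ε * ∑ k, x k ^ 2 := by
  set n := ∑ k, x k ^ 2 with hn
  have hn0 : 0 ≤ n := sum_nonneg fun k _ => sq_nonneg (x k)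
  rcases hn0.eq_or_lt with h0 | h0
  · have hx : x = 0 := by
      ext k
      have := (sum_eq_zero_iff_of_nonneg fun k _ => sq_nonneg (x k)).mp h0.symm k (mem_univ k)
      exact pow_eq_zero_iff two_ne_zero |>.mp this
    rw [← h0, hx, energy_zero]
    simp
  · have ht : ((√n)⁻¹) ^ 2 = n⁻¹ := by rw [inv_pow, Real.sq_sqrt h0.le]
    have h1 := h (√n)⁻¹ (by positivity) (by
      simp only [Pi.smul_apply, smul_eq_mul, mul_pow, ← mul_sum]
      rw [ht, ← hn, inv_mul_cancel₀ h0.ne'])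
    rw [energy_smul, ht] at h1
    have h2 : energy g ω x - n = n * (n⁻¹ * energy g ω x - 1) := by
      rw [mul_sub, mul_inv_cancel_left₀ h0.ne', mul_one]
    rw [h2, abs_mul, abs_of_pos h0, mul_comm]
    exact mul_le_mul_of_nonneg_right h1 h0.le

lemma failure_bound_le {N d r m : ℕ} (hN : 0 < N) (hdN : d ≤ N) {L p ε : ℝ}
    (hL : 1 ≤ L) (hp : 0 < p) (hp1 : p < 1) (hLp : 1000 * (N / p) ≤ Real.exp L) (hε : 0 < ε)
    (hε1 : ε < 1) (hr : 1 ≤ r) (hm : 10 ^ 13 * (r / ε ^ 2) * L ^ 4 ≤ m) :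
    2 * N * d * Real.exp (-(3 * L)) + ((4 * (⌈3 * L⌉₊ : ℝ) ^ 2 * (12 * L * r) ^ 2 +
      8 * ⌈3 * L⌉₊ * (12 * L * r + 1) * m) / (ε * m) ^ 2) ^ ⌈3 * L⌉₊ * d ≤ p / (8 * N) := by
  have hN' : (1 : ℝ) ≤ N := by exact_mod_cast hN
  have hr' : (1 : ℝ) ≤ r := by exact_mod_cast hr
  have hdN' : (d : ℝ) ≤ N := by exact_mod_cast hdN
  have hm0 : (0 : ℝ) < m := lt_of_lt_of_le (by positivity) hm
  have hexp : Real.exp (-(3 * L)) ≤ p / (1000 * N ^ 3) := by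
    rw [Real.exp_neg, inv_le_comm₀ (Real.exp_pos _) (by positivity)]
    have h1 : Real.exp (3 * L) = Real.exp L ^ 3 := by
      rw [← Real.exp_nat_mul]; norm_num
    have h2 : (1 : ℝ) ≤ 1 / p := by rw [le_div_iff₀ hp]; linarith
    calc (p / (1000 * N ^ 3))⁻¹ = 1000 * N ^ 3 * (1 / p) ^ 1 := by
          rw [inv_div]; ring
      _ ≤ 1000 ^ 3 * N ^ 3 * (1 / p) ^ 3 := by
          gcongr
          · norm_num
          · norm_num
      _ = (1000 * (N / p)) ^ 3 := by ring
      _ ≤ _ := by rw [h1]; exact pow_le_pow_left₀ (by positivity) hLp 3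
  set q := ⌈3 * L⌉₊ with hq
  have hq1 : 3 * L ≤ q := Nat.le_ceil _
  have hq2 : (q : ℝ) ≤ 4 * L := by
    have := Nat.ceil_lt_add_one (by positivity : 0 ≤ 3 * L)
    linarith
  have hbase : (4 * (q : ℝ) ^ 2 * (12 * L * r) ^ 2 + 8 * q * (12 * L * r + 1) * m) /
      (ε * m) ^ 2 ≤ Real.exp (-1) := by
    have he : (1 / 3 : ℝ) ≤ Real.exp (-1) := by
      rw [Real.exp_neg, ← one_div]
      exact one_div_le_one_div_of_le (Real.exp_pos _)
        (Real.exp_one_lt_d9.le.trans (by norm_num))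
    refine le_trans ?_ he
    rw [div_le_iff₀ (by positivity)]
    have hm2 : 10 ^ 13 * r * L ^ 4 ≤ ε ^ 2 * m := by
      calc 10 ^ 13 * r * L ^ 4 = ε ^ 2 * (10 ^ 13 * (r / ε ^ 2) * L ^ 4) := by field_simp
        _ ≤ _ := by gcongr
    have hL2 : L ^ 2 ≤ L ^ 4 := pow_le_pow_right₀ hL (by norm_num)
    have hm3 : 10 ^ 13 * (r * L ^ 2) ≤ ε * m := by
      calc 10 ^ 13 * (r * L ^ 2) ≤ 10 ^ 13 * r * L ^ 4 := by
            rw [← mul_assoc]; gcongr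
        _ ≤ ε ^ 2 * m := hm2
        _ ≤ ε * m := by
          gcongr
          nlinarith
    have e1 : 4 * (q : ℝ) ^ 2 * (12 * L * r) ^ 2 ≤ 9216 * (r * L ^ 2) ^ 2 := by
      calc _ ≤ 4 * (4 * L) ^ 2 * (12 * L * r) ^ 2 := by gcongr
        _ = _ := by ring
    have e2 : (10 ^ 13 * (r * L ^ 2)) ^ 2 ≤ (ε * m) ^ 2 :=
      pow_le_pow_left₀ (by positivity) hm3 2
    have e3 : 8 * (q : ℝ) * (12 * L * r + 1) * m ≤ 416 * (r * L ^ 4) * m := by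
      have : (1 : ℝ) ≤ L * r := one_le_mul_of_one_le_of_one_le hL hr'
      calc _ ≤ 8 * (4 * L) * (12 * L * r + L * r) * m := by gcongr
        _ = 416 * (r * L ^ 2) * m := by ring
        _ ≤ _ := by gcongr
    have e4 : 10 ^ 13 * (r * L ^ 4) * m ≤ (ε * m) ^ 2 := by
      calc _ = 10 ^ 13 * r * L ^ 4 * m := by ring
        _ ≤ ε ^ 2 * m * m := by gcongr
        _ = _ := by ring
    nlinarith [sq_nonneg (r * L ^ 2 : ℝ), sq_nonneg (ε * m)]
  have hpow : ((4 * (q : ℝ) ^ 2 * (12 * L * r) ^ 2 + 8 * q * (12 * L * r + 1) * m) /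
      (ε * m) ^ 2) ^ q ≤ Real.exp (-(3 * L)) := by
    refine (pow_le_pow_left₀ (by positivity) hbase q).trans ?_
    rw [← Real.exp_nat_mul]
    exact Real.exp_le_exp.mpr (by linarith)
  calc _ ≤ 2 * N * N * Real.exp (-(3 * L)) + Real.exp (-(3 * L)) * N := by gcongr
    _ ≤ 3 * N ^ 2 * Real.exp (-(3 * L)) := by
        nlinarith [mul_le_mul_of_nonneg_left hN' (by positivity : 0 ≤ N * Real.exp (-(3 * L)))]
    _ ≤ 3 * N ^ 2 * (p / (1000 * N ^ 3)) := by gcongr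
    _ = 3 / 1000 * (p / N) := by field_simp
    _ ≤ 1 / 8 * (p / N) := by
        have : 0 ≤ p / N := by positivity
        linarith
    _ = _ := by ring

/-- Randomly signed and subsampled bounded orthogonal transforms nearly preserve norms on the
span of a fixed family of vectors. -/
lemma pr_not_span_le {N r m : ℕ} (hN : 0 < N) {g : Fin N → Fin N → ℝ}
    (hg : ∀ j k, |g j k| ≤ 1)
    (hg2 : ∀ k l, ∑ j, g j k * g j l = if k = l then (N : ℝ) else 0) (f : ι → Fin N → ℝ)
    (hf : Fintype.card ι ≤ 2 * r) {L p ε : ℝ}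
    (hL : 1 ≤ L) (hp : 0 < p) (hp1 : p < 1) (hLp : 1000 * (N / p) ≤ Real.exp L) (hε : 0 < ε)
    (hε1 : ε < 1) (hr : 1 ≤ r) (hm : 10 ^ 13 * (r / ε ^ 2) * L ^ 4 ≤ m) :
    pr (fun ω : (Fin m → Fin N) × (Fin N → Bool) => ¬ ∀ b : ι → ℝ,
      |energy g ω (fun k => ∑ i, b i * f i k) - ∑ k, (∑ i, b i * f i k) ^ 2| ≤
        ε * ∑ k, (∑ i, b i * f i k) ^ 2) ≤ p / (8 * N) := by
  obtain ⟨d, hd, hdN, w, hw, hspan⟩ := exists_orthonormal_span f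
  have hr' : (1 : ℝ) ≤ r := by exact_mod_cast hr
  have hm0 : 0 < m := by
    have : (0 : ℝ) < m := lt_of_lt_of_le (by positivity) hm
    exact_mod_cast this
  have hdr : (d : ℝ) ≤ 2 * r := by exact_mod_cast hd.trans hf
  have hκ : 2 * (3 * L) * Fintype.card (Fin d) ≤ 12 * L * r := by
    rw [Fintype.card_fin]
    nlinarith
  have key := pr_not_orthonormal_le (q := ⌈3 * L⌉₊) hm0 hN hg hg2
    (fun a b => by convert hw a b)
    (by positivity : 0 ≤ 3 * L) hκ hε
  rw [Fintype.card_fin] at key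
  refine le_trans (pr_mono fun ω hω => ?_) (key.trans
    (failure_bound_le hN hdN hL hp hp1 hLp hε hε1 hr hm))
  contrapose! hω
  intro b
  obtain ⟨c, hc⟩ := hspan b
  refine abs_energy_sub_le_of_unit _ fun t _ ht => ?_
  have hc' : (t • fun k => ∑ i, b i * f i k) = fun k => ∑ i, (t * c i) * w i k := by
    rw [hc]
    ext k
    simp only [Pi.smul_apply, smul_eq_mul, mul_sum, mul_assoc]
  rw [hc'] at ht ⊢
  refine hω _ ?_
  rw [← ht]
  calc ∑ i, (t * c i) ^ 2
      = ∑ i, ∑ j, (t * c i) * (t * c j) * ∑ k, w i k * w j k := by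
        simp only [hw, mul_ite, mul_one, mul_zero, sum_ite_eq, mem_univ, if_true, sq]
    _ = _ := by
        symm
        simp only [sq, sum_mul_sum]
        rw [sum_comm]
        refine sum_congr rfl fun i _ => ?_
        rw [sum_comm]
        refine sum_congr rfl fun j _ => ?_
        rw [mul_sum]
        exact sum_congr rfl fun k _ => by ring

end Combination

section Complex

lemma nsq_eq {n : ℕ} (z : Fin n → ℂ) :
    nsq z = ∑ k, (z k).re ^ 2 + ∑ k, (z k).im ^ 2 := by
  rw [nsq, ← sum_add_distrib]
  refine sum_congr rfl fun k _ => ?_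
  rw [← Complex.normSq_eq_norm_sq, Complex.normSq_apply]
  ring

/-- The squared norm of the image of `z` splits into the energies of its real and imaginary
parts. -/
lemma nsq_sampled_mulVec {N m : ℕ} (H : Matrix (Fin N) (Fin N) ℝ)
    (ω : (Fin m → Fin N) × (Fin N → Bool)) (z : Fin N → ℂ) :
    nsq (((Real.sqrt ((N : ℝ) / m) • (selMat ω.1 * H * diagSign ω.2)).map
      (fun a => (a : ℂ))).mulVec z) =
      energy (fun j k => √N * H j k) ω (fun k => (z k).re) +
        energy (fun j k => √N * H j k) ω (fun k => (z k).im) := by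
  set M := Real.sqrt ((N : ℝ) / m) • (selMat ω.1 * H * diagSign ω.2) with hM
  have hentry : ∀ i k, M i k = √(N / m) * (H (ω.1 i) k * sgn (ω.2 k)) := by
    intro i k
    simp [hM, diagSign, Matrix.mul_apply, selMat, sgn, Matrix.diagonal_apply]
  have hpart : ∀ x : Fin N → ℝ, energy (fun j k => √N * H j k) ω x =
      ∑ i, (∑ k, M i k * x k) ^ 2 := by
    intro x
    rw [energy, sum_div]
    refine sum_congr rfl fun i _ => ?_
    have h1 : ∑ k, M i k * x k = √(N / m) * ∑ k, H (ω.1 i) k * (sgn (ω.2 k) * x k) := by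
      rw [mul_sum]
      exact sum_congr rfl fun k _ => by rw [hentry]; ring
    have h2 : ∑ k, √N * H (ω.1 i) k * (sgn (ω.2 k) * x k) =
        √N * ∑ k, H (ω.1 i) k * (sgn (ω.2 k) * x k) := by
      rw [mul_sum]
      exact sum_congr rfl fun k _ => by ring
    rw [h1, h2, mul_pow, mul_pow, Real.sq_sqrt (by positivity), Real.sq_sqrt (by positivity)]
    ring
  rw [nsq_eq, hpart, hpart]
  congr 1
  · refine sum_congr rfl fun i _ => ?_
    simp [Matrix.mulVec, dotProduct]
  · refine sum_congr rfl fun i _ => ?_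
    simp [Matrix.mulVec, dotProduct]

/-- The `ε`-JL inequality at a single complex vector, in terms of energies. -/
def NormPreserved {N m : ℕ} (g : Fin N → Fin N → ℝ) (ω : (Fin m → Fin N) × (Fin N → Bool))
    (ε : ℝ) (z : Fin N → ℂ) : Prop :=
  (1 - ε) * nsq z ≤ energy g ω (fun k => (z k).re) + energy g ω (fun k => (z k).im) ∧
    energy g ω (fun k => (z k).re) + energy g ω (fun k => (z k).im) ≤ (1 + ε) * nsq z

lemma normPreserved_of_abs_le {N m : ℕ} {g : Fin N → Fin N → ℝ}
    {ω : (Fin m → Fin N) × (Fin N → Bool)} {ε : ℝ} {z : Fin N → ℂ}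
    (hre : |energy g ω (fun k => (z k).re) - ∑ k, (z k).re ^ 2| ≤ ε * ∑ k, (z k).re ^ 2)
    (him : |energy g ω (fun k => (z k).im) - ∑ k, (z k).im ^ 2| ≤ ε * ∑ k, (z k).im ^ 2) :
    NormPreserved g ω ε z := by
  rw [abs_le] at hre him
  rw [NormPreserved, nsq_eq]
  constructor <;> linarith [hre.1, hre.2, him.1, him.2]

variable {ι : Type*} [Fintype ι]

lemma pr_not_complex_span_le {N r m : ℕ} (hN : 0 < N) {g : Fin N → Fin N → ℝ}
    (hg : ∀ j k, |g j k| ≤ 1)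
    (hg2 : ∀ k l, ∑ j, g j k * g j l = if k = l then (N : ℝ) else 0) (U : ι → Fin N → ℂ)
    (hU : Fintype.card ι ≤ r) {L p ε : ℝ}
    (hL : 1 ≤ L) (hp : 0 < p) (hp1 : p < 1) (hLp : 1000 * (N / p) ≤ Real.exp L) (hε : 0 < ε)
    (hε1 : ε < 1) (hr : 1 ≤ r) (hm : 10 ^ 13 * (r / ε ^ 2) * L ^ 4 ≤ m) :
    pr (fun ω : (Fin m → Fin N) × (Fin N → Bool) => ¬ ∀ c : ι → ℂ,
      NormPreserved g ω ε (fun k => ∑ i, c i * U i k)) ≤ p / (8 * N) := by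
  refine le_trans (pr_mono fun ω hω => ?_) (pr_not_span_le (ι := ι ⊕ ι) hN hg hg2
    (Sum.elim (fun i k => (U i k).re) (fun i k => (U i k).im))
    (by rw [Fintype.card_sum]; omega) hL hp hp1 hLp hε hε1 hr hm)
  contrapose! hω
  intro c
  refine normPreserved_of_abs_le ?_ ?_
  · convert hω (Sum.elim (fun i => (c i).re) (fun i => -(c i).im)) using 4 <;>
      simp [sub_eq_add_neg, sum_add_distrib]
  · convert hω (Sum.elim (fun i => (c i).im) (fun i => (c i).re)) using 4 <;>
      simp [sum_add_distrib, add_comm]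

/-- Subsampled bounded orthogonal transforms have the restricted isometry property, whatever the
signs. -/
lemma pr_not_sparse_le {N m S : ℕ} (hN : 0 < N) {g : Fin N → Fin N → ℝ}
    (hg : ∀ j k, |g j k| ≤ 1)
    (hg2 : ∀ k l, ∑ j, g j k * g j l = if k = l then (N : ℝ) else 0)
    (hS : 1 ≤ S) {L p : ℝ} (hL : 1 ≤ L) (hNL : 4 * N ≤ Real.exp L) (hSL : 20 * √S ≤ Real.exp L)
    (hp : 0 < p) (hpL : 2 / p ≤ Real.exp L) (hm : 10 ^ 12 * S * L ^ 3 ≤ m) :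
    pr (fun ω : (Fin m → Fin N) × (Fin N → Bool) => ¬ ∀ z : Fin N → ℂ,
      Set.ncard {i | z i ≠ 0} ≤ S → NormPreserved g ω 0.1 z) ≤ p := by
  have hiso : ∀ x : Fin N → ℝ, ∑ j, (∑ k, g j k * x k) ^ 2 = N * ∑ k, x k ^ 2 := by
    intro x
    have := sum_signed_mul_signed hg2 (fun _ => true) x x
    simpa [sgn, ← sq] using this
  have key := pr_not_rip_le hN g hg hiso hS hL hNL hSL hp hpL hm
  set G : (Fin m → Fin N) → Prop := fun ρ => ∀ x : Fin N → ℝ,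
    (univ.filter fun k => x k ≠ 0).card ≤ S → ∑ k, x k ^ 2 = 1 →
      |(∑ i, (∑ k, g (ρ i) k * x k) ^ 2) / m - 1| ≤ 1 / 10 with hG
  have hmain : pr (fun ω : (Fin m → Fin N) × (Fin N → Bool) => ¬ G ω.1) ≤ p := by
    refine le_trans (le_of_eq ?_) key
    rw [pr, av_prod, pr]
    congr 1
    ext ρ
    convert av_const (α := Fin N → Bool) (if ¬ G ρ then (1 : ℝ) else 0)
  refine le_trans (pr_mono fun ω hω => ?_) hmain
  contrapose! hω
  intro z hz
  have hreal : ∀ x : Fin N → ℝ, (∀ k, z k = 0 → x k = 0) →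
      |energy g ω x - ∑ k, x k ^ 2| ≤ 0.1 * ∑ k, x k ^ 2 := by
    intro x hx
    refine abs_energy_sub_le_of_unit x fun t ht hunit => ?_
    have := hω (fun k => sgn (ω.2 k) * (t • x) k) ?_ ?_
    · norm_num at this ⊢
      exact this
    · refine le_trans ?_ hz
      rw [← Set.ncard_coe_finset]
      refine Set.ncard_le_ncard ?_ (Set.toFinite _)
      intro k hk
      simp only [coe_filter, mem_univ, true_and, Set.mem_ofPred_eq] at hk ⊢
      intro h0
      apply hk
      simp [hx k h0]
    · rw [← hunit]
      refine sum_congr rfl fun k _ => ?_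
      rw [mul_pow, sq (sgn _), sgn_mul_self, one_mul]
  exact normPreserved_of_abs_le (hreal _ fun k hk => by simp [hk])
    (hreal _ fun k hk => by simp [hk])

lemma headMat_mulVec {N : ℕ} (lam : Fin N → ℝ) (u v : Fin N → Fin N → ℂ) (r : ℕ)
    (x : Fin N → ℂ) :
    ∃ c : {j : Fin N // (j : ℕ) < r} → ℂ,
      (headMat lam u v r).mulVec x = fun k => ∑ j, c j * u j k := by
  refine ⟨fun j => lam j * ∑ l, (starRingEnd ℂ) (v j l) * x l, ?_⟩
  ext k
  have h : ∀ j : Fin N, ((if (j : ℕ) < r then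
      lam j • Matrix.vecMulVec (u j) (fun k => (starRingEnd ℂ) (v j k)) else 0).mulVec x) k =
      if (j : ℕ) < r then (lam j * ∑ l, (starRingEnd ℂ) (v j l) * x l) * u j k else 0 := by
    intro j
    split_ifs
    · simp [Matrix.smul_mulVec, Matrix.vecMulVec_mulVec, dotProduct]
      ring
    · simp
  rw [headMat, Matrix.sum_mulVec, Finset.sum_apply]
  simp only [h]
  rw [← sum_filter]
  exact Finset.sum_subtype _ (by simp) _

lemma headMat_conjTranspose {N : ℕ} (lam : Fin N → ℝ) (u v : Fin N → Fin N → ℂ) (r : ℕ) :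
    (headMat lam u v r)ᴴ = headMat lam v u r := by
  rw [headMat, headMat, Matrix.conjTranspose_sum]
  refine sum_congr rfl fun j _ => ?_
  split_ifs
  · ext a b
    simp [Matrix.vecMulVec_apply, mul_comm]
  · simp

end Complex

end SubsampledHadamard

open SubsampledHadamard

/-- A randomly subsampled randomly-signed Hadamard matrix
`M = √(N/m)·R·H·D` with `m ≳ max{s, r/ε²}·log⁴(N/(pε²))` rows simultaneously has the RIP of
order `(4s, 0.1)` and is an ε-JL map of the column spaces of `A_r`, `A_r*` and of the trailing
singular vectors of `A`, with probability at least `1 − p`. -/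
theorem stmt_12 :
    ∃ c₁ c₂ : ℝ, 0 < c₁ ∧ 0 < c₂ ∧
      ∀ (N : ℕ), (∃ k : ℕ, N = 2 ^ k) →
      ∀ (A : Matrix (Fin N) (Fin N) ℂ) (lam : Fin N → ℝ) (u v : Fin N → Fin N → ℂ),
        (∀ i j : Fin N, i ≤ j → lam j ≤ lam i) → (∀ j, 0 ≤ lam j) →
        (∀ i j, ∑ k, (starRingEnd ℂ) (u i k) * u j k = if i = j then 1 else 0) →
        (∀ i j, ∑ k, (starRingEnd ℂ) (v i k) * v j k = if i = j then 1 else 0) →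
        A = (∑ j, lam j • Matrix.vecMulVec (u j) (fun k => (starRingEnd ℂ) (v j k))) →
      ∀ (s r : ℕ), 1 ≤ s → s ≤ N → 1 ≤ r → r ≤ N →
      ∀ (ε p : ℝ), 0 < ε → ε < 1 → 0 < p → p < 1 →
      ∀ (H : Matrix (Fin N) (Fin N) ℝ),
        Hᵀ = H → H * Hᵀ = 1 →
        (∀ i j, H i j = (Real.sqrt N)⁻¹ ∨ H i j = -(Real.sqrt N)⁻¹) →
      ∀ (m : ℕ), m ≤ N →
        c₁ * max (s : ℝ) (r / ε ^ 2) * Real.log (c₂ * N / (p * ε ^ 2)) ^ 4 ≤ m →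
      ((Finset.univ.filter (fun ω : (Fin m → Fin N) × (Fin N → Bool) =>
          RIP (Real.sqrt ((N : ℝ) / m) • (selMat ω.1 * H * diagSign ω.2)) (4 * s) 0.1 ∧
          IsJLMapR (Real.sqrt ((N : ℝ) / m) • (selMat ω.1 * H * diagSign ω.2)) ε
            (Set.range (headMat lam u v r).mulVec) ∧
          IsJLMapR (Real.sqrt ((N : ℝ) / m) • (selMat ω.1 * H * diagSign ω.2)) ε
            (Set.range ((headMat lam u v r)ᴴ).mulVec) ∧
          IsJLMapR (Real.sqrt ((N : ℝ) / m) • (selMat ω.1 * H * diagSign ω.2)) ε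
            {x | ∃ j : Fin N, r ≤ (j : ℕ) ∧ (x = u j ∨ x = v j)})).card : ℝ) /
        (Fintype.card ((Fin m → Fin N) × (Fin N → Bool))) ≥ 1 - p := by
  refine ⟨10 ^ 13, 1000, by norm_num, by norm_num, ?_⟩
  rintro N ⟨n, hn⟩ A lam u v - - - - - s r hs hsN hr - ε p hε hε1 hp hp1 H hHt hH hHent m - hm
  have hN : 0 < N := hn ▸ Nat.two_pow_pos n
  have hN' : (1 : ℝ) ≤ N := by exact_mod_cast hN
  have hsN' : (s : ℝ) ≤ N := by exact_mod_cast hsN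
  have hs' : (1 : ℝ) ≤ s := by exact_mod_cast hs
  set L := Real.log (1000 * N / (p * ε ^ 2)) with hLdef
  have hexp : Real.exp L = 1000 * N / (p * ε ^ 2) := Real.exp_log (by positivity)
  have hLp : 1000 * ((N : ℝ) / p) ≤ Real.exp L := by
    rw [hexp, ← mul_div_assoc]
    exact div_le_div_of_nonneg_left (by positivity) (by positivity)
      (mul_le_of_le_one_right hp.le (pow_le_one₀ hε.le hε1.le))
  have hNp : (N : ℝ) ≤ N / p := by
    rw [le_div_iff₀ hp]
    nlinarith
  have hp2 : 1 / p ≤ N / p := div_le_div_of_nonneg_right hN' hp.le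
  have hL : 1 ≤ L := by
    rw [← Real.exp_le_exp]
    linarith [Real.exp_one_lt_d9]
  have hmr : 10 ^ 13 * ((r : ℝ) / ε ^ 2) * L ^ 4 ≤ m :=
    le_trans (by gcongr; exact le_max_right _ _) hm
  have hms : 10 ^ 12 * ((4 * s : ℕ) : ℝ) * L ^ 3 ≤ m := by
    refine le_trans ?_ ((by gcongr; exact le_max_left _ _ :
      10 ^ 13 * (s : ℝ) * L ^ 4 ≤ _).trans hm)
    push_cast
    have : L ^ 3 ≤ L ^ 4 := pow_le_pow_right₀ hL (by norm_num)
    calc _ = 4 * 10 ^ 12 * (s : ℝ) * L ^ 3 := by ring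
      _ ≤ 10 ^ 13 * (s : ℝ) * L ^ 4 := by gcongr; norm_num
  have hsqrt : √((4 * s : ℕ) : ℝ) ≤ 4 * N := by
    rw [Real.sqrt_le_left (by positivity)]
    push_cast
    nlinarith
  set g : Fin N → Fin N → ℝ := fun j k => √N * H j k with hgdef
  have hsN0 : √(N : ℝ) ≠ 0 := by positivity
  have hg : ∀ j k, |g j k| ≤ 1 := by
    intro j k
    rcases hHent j k with h | h <;> simp [hgdef, h, hsN0]
  have hg2 : ∀ k l, ∑ j, g j k * g j l = if k = l then (N : ℝ) else 0 := by
    intro k l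
    have h1 : (H * Hᵀ) k l = (1 : Matrix (Fin N) (Fin N) ℝ) k l := by rw [hH]
    have h2 : ∀ j k, H j k = H k j := fun j k => congrFun (congrFun hHt k) j
    rw [Matrix.mul_apply, Matrix.one_apply] at h1
    simp only [Matrix.transpose_apply] at h1
    calc _ = N * ∑ j, H k j * H l j := by
          rw [Finset.mul_sum]
          refine Finset.sum_congr rfl fun j _ => ?_
          rw [hgdef, h2 k, h2 l]
          linear_combination H j k * H j l * Real.mul_self_sqrt (Nat.cast_nonneg (α := ℝ) N)
      _ = _ := by rw [h1]; split_ifs <;> simp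
  have hsparse := pr_not_sparse_le (m := m) (S := 4 * s) hN hg hg2 (by omega) hL
    (by linarith) (by linarith) (half_pos hp)
    (by rw [div_div_eq_mul_div, show (2 : ℝ) * 2 / p = 4 * (1 / p) by ring]; linarith) hms
  have hcard : Fintype.card {j : Fin N // (j : ℕ) < r} ≤ r := by
    have := Fintype.card_le_of_injective
      (fun j : {j : Fin N // (j : ℕ) < r} => (⟨j.1, j.2⟩ : Fin r))
      fun a b h => by simpa [Fin.ext_iff, Subtype.ext_iff] using h
    rwa [Fintype.card_fin] at this
  have hhead : ∀ w : Fin N → Fin N → ℂ, _ := fun w =>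
    pr_not_complex_span_le (m := m) hN hg hg2 (fun j : {j : Fin N // (j : ℕ) < r} => w j) hcard
      hL hp hp1 hLp hε hε1 hr hmr
  have hsingle : ∀ w : Fin N → Fin N → ℂ, ∀ j, _ := fun w j =>
    pr_not_complex_span_le (m := m) hN hg hg2 (fun _ : Unit => w j) (by simpa using hr)
      hL hp hp1 hLp hε hε1 hr hmr
  have hall : ∀ w : Fin N → Fin N → ℂ, _ := fun w =>
    (pr_exists_le _).trans (Finset.sum_le_sum fun j (_ : j ∈ Finset.univ) => hsingle w j)
  have : Nonempty (Fin N) := ⟨⟨0, hN⟩⟩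
  refine ge_iff_le.mpr (le_trans ?_ (one_sub_pr_not_le _))
  rw [sub_le_sub_iff_left]
  refine (pr_mono ?_).trans ((pr_or_le _ _).trans (add_le_add hsparse ((pr_or_le _ _).trans
    (add_le_add (hhead u) ((pr_or_le _ _).trans (add_le_add (hhead v)
      ((pr_or_le _ _).trans (add_le_add (hall u) (hall v)))))))) |>.trans ?_)
  · intro ω hω
    contrapose! hω
    obtain ⟨h1, h2, h3, h4, h5⟩ := hω
    refine ⟨fun z hz => ?_, ?_, ?_, ?_⟩
    · rw [nsq_sampled_mulVec]
      exact h1 z hz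
    · rintro _ ⟨x, rfl⟩
      obtain ⟨c, hc⟩ := headMat_mulVec lam u v r x
      rw [nsq_sampled_mulVec, hc]
      exact h2 c
    · rintro _ ⟨x, rfl⟩
      obtain ⟨c, hc⟩ := headMat_mulVec lam v u r x
      rw [nsq_sampled_mulVec, headMat_conjTranspose, hc]
      exact h3 c
    · rintro x ⟨j, -, rfl | rfl⟩
      · rw [nsq_sampled_mulVec]
        have := h4 j fun _ => 1
        simp only [Finset.univ_unique, Finset.sum_const, Finset.card_singleton, one_smul,
          one_mul] at this
        exact this
      · rw [nsq_sampled_mulVec]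
        have := h5 j fun _ => 1
        simp only [Finset.univ_unique, Finset.sum_const, Finset.card_singleton, one_smul,
          one_mul] at this
        exact this
  · simp only [Finset.sum_const, Finset.card_univ, Fintype.card_fin, nsmul_eq_mul]
    have h1 : (N : ℝ) * (p / (8 * N)) = p / 8 := by field_simp
    have h2 : p / (8 * N) ≤ p / 8 := by
      apply div_le_div_of_nonneg_left hp.le (by norm_num)
      linarith
    linarith
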